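/- Fix 0 < α < 3, a real p with max(4, 2α) < p < 6, and s < 1/2. There exists a constant C > 0 such that for all integers i ≥ 1 and N ≥ 1 there is a Borel set Σ_N^i ⊆ ℝ^{2N} with ρ_N(ℝ^{2N} ∖ Σ_N^i) ≤ 2^{−i}, and such that for every x ∈ Σ_N^i and every t ∈ ℝ, ‖S(τ)(u_{Φ_N(t,x)})‖_{L^p((0,2)_τ × Θ)} + ‖u_{Φ_N(t,x)}‖_{H^s(Θ)} ≤ C (i + log(1+|t|))^{1/2}. -/

import Mathlib

open MeasureTheory Set ENNReal NNReal

noncomputable section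

/-- The ambient Euclidean space `ℝ³`. -/
abbrev E3 := EuclideanSpace ℝ (Fin 3)

/-- Lebesgue measure restricted to the unit ball `Θ` of `ℝ³`. -/
def μΘ : Measure E3 := volume.restrict (Metric.ball 0 1)

/-- The `L²`-normalized radial Dirichlet eigenfunctions
`e_n(x) = sin (nπ|x|) / (√(2π)|x|)` of the unit ball of `ℝ³`. -/
def eFun (n : ℕ) (x : E3) : ℝ :=
  Real.sin (n * Real.pi * ‖x‖) / (Real.sqrt (2 * Real.pi) * ‖x‖)

/-- The `H^σ(Θ)` norm of the radial function with coefficients `c`, i.e. of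
`u = ∑_{n ≥ 1} c_{n-1} e_n` : `‖u‖² = ∑_{n≥1} (πn)^{2σ} |c_{n-1}|²`. -/
def HNorm (σ : ℝ) (c : ℕ → ℂ) : ℝ≥0∞ :=
  (∑' n : ℕ, ENNReal.ofReal ((Real.pi * (n + 1)) ^ (2 * σ)) * (‖c n‖₊ : ℝ≥0∞) ^ 2) ^ (1/2 : ℝ)

/-- The radial function `∑_{n ≥ 1} c_{n-1} e_n` associated to a coefficient sequence. -/
def vFun (c : ℕ → ℂ) (x : E3) : ℂ := ∑' n : ℕ, c n * (eFun (n + 1) x : ℂ)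

/-- The free evolution `S(t) = e^{-it√(-Δ)}` acting on coefficient sequences:
the `n`-th coefficient is multiplied by `e^{-iπnt}`. -/
def Sc (t : ℝ) (c : ℕ → ℂ) (n : ℕ) : ℂ :=
  Complex.exp (-(Real.pi * (n + 1) * t) * Complex.I) * c n

/-- The mixed norm `‖f‖_{L^p((-T,T);L^q(Θ))}`. -/
def mixedNorm (p q : ℝ≥0∞) (T : ℝ) (f : ℝ → E3 → ℂ) : ℝ≥0∞ :=
  eLpNorm (fun t => (eLpNorm (f t) q μΘ).toReal) p (volume.restrict (Set.Ioo (-T) T))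

/-- The exponent `p_σ = 2/σ`. -/
def pSig (σ : ℝ) : ℝ≥0∞ := ENNReal.ofReal (2 / σ)

/-- The exponent `q_σ` with `1/p_σ + 1/q_σ = 1/2`, i.e. `q_σ = 2/(1-σ)`. -/
def qSig (σ : ℝ) : ℝ≥0∞ := ENNReal.ofReal (2 / (1 - σ))

/-- The `X^σ_T` norm: `sup_{|t| ≤ T} ‖v(t)‖_{H^σ} + ‖v‖_{L^{p_σ}((-T,T);L^{q_σ}(Θ))}`,
for a curve `v` of coefficient sequences. -/
def XNorm (σ : ℝ) (T : ℝ) (v : ℝ → ℕ → ℂ) : ℝ≥0∞ :=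
  (⨆ t ∈ Set.Icc (-T) T, HNorm σ (v t)) + mixedNorm (pSig σ) (qSig σ) T (fun t => vFun (v t))

/-- Membership in `X^σ_T = C([-T,T];H^σ(Θ)) ∩ L^{p_σ}((-T,T);L^{q_σ}(Θ))`:
continuity in `H^σ` on `[-T,T]` together with finiteness of the `X^σ_T` norm. -/
def MemX (σ T : ℝ) (v : ℝ → ℕ → ℂ) : Prop :=
  (∀ t ∈ Set.Icc (-T) T,
    Filter.Tendsto (fun s => HNorm σ (fun n => v s n - v t n))
      (nhdsWithin t (Set.Icc (-T) T)) (nhds 0)) ∧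
  XNorm σ T v < ⊤

/-- The coefficients of the Duhamel term `D(g)(t) = -i∫₀ᵗ S(t-τ) √(-Δ)⁻¹ g(τ) dτ`:
the `n`-th coefficient is `-i(πn)⁻¹ ∫₀ᵗ e^{-iπn(t-τ)} (∫_Θ g(τ,x) e_n(x) dx) dτ`. -/
def Dcoef (g : ℝ → E3 → ℂ) (t : ℝ) (n : ℕ) : ℂ :=
  -Complex.I * (Real.pi * (n + 1))⁻¹ *
    ∫ τ in (0:ℝ)..t, Complex.exp (-(Real.pi * (n + 1) * (t - τ)) * Complex.I) *
      ∫ x, g τ x * (eFun (n + 1) x : ℂ) ∂μΘ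

/-- The nonlinearity `F(z) = |Re z|^α Re z`. -/
def Fnl (α : ℝ) (z : ℂ) : ℝ := |z.re| ^ α * z.re

/-- The space-time norm `‖f‖_{L^p(S × Θ)}` (product Lebesgue measure). -/
def stLp (p : ℝ≥0∞) (S : Set ℝ) (f : ℝ → E3 → ℂ) : ℝ≥0∞ :=
  eLpNorm (fun z : ℝ × E3 => f z.1 z.2) p ((volume.restrict S).prod μΘ)


/-- The truncated radial function `w_a = ∑_{m=1}^N χ(m²/N²) a_m e_m`. -/
def wA {N : ℕ} (χ : ℝ → ℝ) (a : Fin N → ℝ) (x : E3) : ℝ :=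
  ∑ m : Fin N, χ (((m : ℕ) + 1 : ℝ) ^ 2 / (N : ℝ) ^ 2) * a m * eFun ((m : ℕ) + 1) x

/-- The Hamiltonian
`H(a,b) = (1/2) ∑_{n=1}^N (πn)²(a_n² + b_n²) + (1/(α+2)) ∫_Θ |w_a|^{α+2}`. -/
def Ham {N : ℕ} (χ : ℝ → ℝ) (α : ℝ) (ab : (Fin N → ℝ) × (Fin N → ℝ)) : ℝ :=
  (1/2) * ∑ n : Fin N, (Real.pi * ((n : ℕ) + 1)) ^ 2 * ((ab.1 n) ^ 2 + (ab.2 n) ^ 2)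
    + (1/(α + 2)) * ∫ x, |wA χ ab.1 x| ^ (α + 2) ∂μΘ

/-- The Gibbs-type measure `ρ_N` on `ℝ^N × ℝ^N = ℝ^{2N}` with density
`(2π)^{-N} (∏_{n=1}^N (πn)²) exp(-H(a,b))` with respect to Lebesgue measure. -/
def rhoN (N : ℕ) (χ : ℝ → ℝ) (α : ℝ) : Measure ((Fin N → ℝ) × (Fin N → ℝ)) :=
  volume.withDensity fun ab => ENNReal.ofReal
    (((2 * Real.pi) ^ N)⁻¹ * (∏ n : Fin N, (Real.pi * ((n : ℕ) + 1)) ^ 2) *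
      Real.exp (-(Ham χ α ab)))

/-- The coefficient sequence of `u_x = ∑_{n=1}^N (a_n + i b_n) e_n` for
`x = (a,b) ∈ ℝ^{2N}`. -/
def coefFin {N : ℕ} (ab : (Fin N → ℝ) × (Fin N → ℝ)) (n : ℕ) : ℂ :=
  if h : n < N then ((ab.1 ⟨n, h⟩ : ℂ) + (ab.2 ⟨n, h⟩ : ℂ) * Complex.I) else 0

section

lemma measurable_eFun (n : ℕ) : Measurable (eFun n) := by
  unfold eFun
  fun_prop

lemma one_le_sqrt_two_pi : 1 ≤ Real.sqrt (2 * Real.pi) := by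
  rw [Real.one_le_sqrt]
  nlinarith [Real.pi_gt_three]

lemma eFun_zero (n : ℕ) : eFun n 0 = 0 := by simp [eFun]

lemma abs_eFun_le (n : ℕ) (x : E3) : |eFun n x| ≤ n * Real.pi := by
  by_cases hx : x = 0
  · subst hx; rw [eFun_zero]; simp; positivity
  have hx' : 0 < ‖x‖ := norm_pos_iff.2 hx
  have h1 := one_le_sqrt_two_pi
  unfold eFun
  rw [abs_div, abs_of_pos (by positivity : 0 < Real.sqrt (2 * Real.pi) * ‖x‖),
    div_le_iff₀ (by positivity)]
  have h2 := Real.abs_sin_le_abs (x := n * Real.pi * ‖x‖)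
  have : 0 ≤ n * Real.pi * ‖x‖ := by positivity
  rw [abs_of_nonneg this] at h2
  nlinarith

lemma abs_eFun_le' (n : ℕ) (x : E3) : |eFun n x| ≤ ‖x‖⁻¹ := by
  by_cases hx : x = 0
  · subst hx; rw [eFun_zero]; simp
  have hx' : 0 < ‖x‖ := norm_pos_iff.2 hx
  have h1 := one_le_sqrt_two_pi
  unfold eFun
  rw [abs_div, abs_of_pos (by positivity : 0 < Real.sqrt (2 * Real.pi) * ‖x‖),
    div_le_iff₀ (by positivity)]
  have h2 := Real.abs_sin_le_one (n * Real.pi * ‖x‖)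
  have : ‖x‖⁻¹ * (Real.sqrt (2 * Real.pi) * ‖x‖) = Real.sqrt (2 * Real.pi) := by field_simp
  linarith

lemma hasSum_sin_sq {r : ℝ} (hr : r ∈ Icc (0:ℝ) 1) :
    HasSum (fun n : ℕ => Real.sin (n * Real.pi * r) ^ 2 / (n:ℝ) ^ 2)
      (Real.pi ^ 2 * (r - r ^ 2) / 2) := by
  have h1 := hasSum_one_div_nat_pow_mul_cos (k := 1) one_ne_zero hr
  have h2 := hasSum_zeta_two
  have h3 := (h2.sub h1).mul_left (1/2)
  convert! h3 using 1
  · funext n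
    have : Real.cos (2 * Real.pi * n * r) = 1 - 2 * Real.sin (n * Real.pi * r) ^ 2 := by
      rw [show 2 * Real.pi * n * r = 2 * (n * Real.pi * r) by ring, Real.cos_two_mul,
        Real.cos_sq']; ring
    rw [this]
    ring
  · have : Polynomial.eval r (Polynomial.map (algebraMap ℚ ℝ) (Polynomial.bernoulli (2 * 1))) =
      r ^ 2 - r + 6⁻¹ := bernoulliFun_two r
    rw [this]
    norm_num [Nat.factorial]
    ring

lemma eFun_sq_sum (N : ℕ) (x : E3) (hx : ‖x‖ ≤ 1) :
    ‖x‖ * ∑ n : Fin N, eFun ((n:ℕ) + 1) x ^ 2 / (Real.pi * ((n:ℕ) + 1)) ^ 2 ≤ 1 := by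
  by_cases hx0 : x = 0
  · subst hx0; simp
  have hx' : 0 < ‖x‖ := norm_pos_iff.2 hx0
  have h := hasSum_sin_sq (r := ‖x‖) ⟨hx'.le, hx⟩
  have h1 := sum_le_hasSum (Finset.range (N+1)) (fun n _ => by positivity) h
  rw [Finset.sum_range_succ'] at h1
  simp only [Nat.cast_zero, zero_mul, Real.sin_zero] at h1
  have h2 : ∑ n : Fin N, eFun ((n:ℕ) + 1) x ^ 2 / (Real.pi * ((n:ℕ) + 1)) ^ 2
      = (1 / (2 * Real.pi * ‖x‖ ^ 2 * Real.pi ^ 2)) * ∑ n ∈ Finset.range N,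
        Real.sin ((n+1 : ℕ) * Real.pi * ‖x‖) ^ 2 / ((n + 1 : ℕ) : ℝ) ^ 2 := by
    rw [Finset.sum_range, Finset.mul_sum]
    refine Finset.sum_congr rfl fun n _ => ?_
    unfold eFun
    rw [div_pow, mul_pow, Real.sq_sqrt (by positivity)]
    push_cast
    field_simp
  rw [h2]
  have hp := Real.pi_gt_three
  have h3 : ∑ n ∈ Finset.range N,
        Real.sin ((n+1 : ℕ) * Real.pi * ‖x‖) ^ 2 / ((n + 1 : ℕ) : ℝ) ^ 2
        ≤ Real.pi ^ 2 * ‖x‖ := by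
    have : 0 ≤ Real.pi ^ 2 * ‖x‖^2 := by positivity
    have : 0 ≤ Real.pi ^ 2 * ‖x‖ := by positivity
    norm_num at h1 ⊢
    nlinarith
  calc _ ≤ ‖x‖ * ((1 / (2 * Real.pi * ‖x‖ ^ 2 * Real.pi ^ 2)) * (Real.pi ^ 2 * ‖x‖)) := by
        gcongr
    _ = 1 / (2 * Real.pi) := by field_simp
    _ ≤ 1 := by rw [div_le_one (by positivity)]; linarith

lemma lintegral_norm_rpow {a : ℝ} (ha : a < 3) :
    ∫⁻ x, ENNReal.ofReal (‖x‖ ^ (-a)) ∂μΘ < ⊤ := by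
  have h : IntegrableOn (fun x : E3 => ‖x‖ ^ (-a)) (Metric.ball 0 1) volume := by
    rw [integrableOn_fun_norm_addHaar (μ := (volume : Measure E3)) (f := fun y => y ^ (-a))]
    have h2 := intervalIntegral.intervalIntegrable_rpow' (a := 0) (b := 1) (r := 2 - a) (by linarith)
    rw [intervalIntegrable_iff_integrableOn_Ioo_of_le zero_le_one] at h2
    refine h2.congr_fun (fun y hy => ?_) measurableSet_Ioo
    simp only [finrank_euclideanSpace, Fintype.card_fin, smul_eq_mul]
    rw [sub_eq_add_neg, Real.rpow_add hy.1]
    norm_num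
  exact h.lintegral_lt_top

instance : IsFiniteMeasure μΘ := by
  unfold μΘ
  constructor
  simp

lemma ae_μΘ : ∀ᵐ x ∂μΘ, ‖x‖ ≤ 1 := by
  unfold μΘ
  filter_upwards [ae_restrict_mem measurableSet_ball] with x hx
  simpa using (mem_ball_zero_iff.1 hx).le

end

section

/-- the variance of the `n`-th Gaussian mode -/
def vr (n : ℕ) : ℝ≥0 := ⟨((Real.pi * (n + 1)) ^ 2)⁻¹, by positivity⟩

lemma vr_ne (n : ℕ) : vr n ≠ 0 := by
  have : (0:ℝ) < vr n := by
    change 0 < ((Real.pi * ((n:ℝ) + 1)) ^ 2)⁻¹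
    positivity
  intro h
  rw [h] at this
  simp at this

lemma gauss1_int (n : ℕ) (t : ℝ) :
    Integrable (fun a => ProbabilityTheory.gaussianPDFReal 0 (vr n) a * Real.exp (t * a)) := by
  have h := ProbabilityTheory.integrable_exp_mul_gaussianReal (μ := 0) (v := vr n) t
  rw [ProbabilityTheory.gaussianReal_of_var_ne_zero _ (vr_ne n),
    integrable_withDensity_iff (ProbabilityTheory.measurable_gaussianPDF _ _)
      (by simp [ProbabilityTheory.gaussianPDF])] at h
  refine h.congr ?_
  filter_upwards with a
  rw [ProbabilityTheory.toReal_gaussianPDF, mul_comm]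

lemma gauss1_val (n : ℕ) (t : ℝ) :
    ∫ a, ProbabilityTheory.gaussianPDFReal 0 (vr n) a * Real.exp (t * a)
      = Real.exp (t ^ 2 / (Real.pi * (n + 1)) ^ 2 / 2) := by
  have h := ProbabilityTheory.mgf_id_gaussianReal (μ := 0) (v := vr n)
  have h := congrFun h t
  simp only [ProbabilityTheory.mgf, id] at h
  rw [ProbabilityTheory.integral_gaussianReal_eq_integral_smul (vr_ne n)] at h
  simp only [smul_eq_mul] at h
  rw [h]
  congr 1
  change _ + ((Real.pi * ((n:ℝ) + 1)) ^ 2)⁻¹ * t ^ 2 / 2 = _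
  ring

lemma rho_le {N : ℕ} (χ : ℝ → ℝ) (α : ℝ) (hα : 0 < α) :
    rhoN N χ α ≤ (volume : Measure ((Fin N → ℝ) × (Fin N → ℝ))).withDensity fun ab =>
      ENNReal.ofReal ((∏ n : Fin N, ProbabilityTheory.gaussianPDFReal 0 (vr n) (ab.1 n)) *
        ∏ n : Fin N, ProbabilityTheory.gaussianPDFReal 0 (vr n) (ab.2 n)) := by
  refine withDensity_mono ?_
  filter_upwards with ab
  refine ENNReal.ofReal_le_ofReal ?_
  have key : ∀ (n : Fin N) (x : ℝ), ProbabilityTheory.gaussianPDFReal 0 (vr n) x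
      = (Real.pi * ((n:ℕ) + 1)) * (Real.sqrt (2 * Real.pi))⁻¹ *
        Real.exp (-((1/2) * ((Real.pi * ((n:ℕ) + 1)) ^ 2 * x ^ 2))) := by
    intro n x
    unfold ProbabilityTheory.gaussianPDFReal
    have hv : ((vr n : ℝ≥0) : ℝ) = ((Real.pi * ((n:ℕ) + 1)) ^ 2)⁻¹ := rfl
    rw [hv]
    have hpos : 0 < Real.pi * (((n:ℕ):ℝ) + 1) := by positivity
    congr 1
    · rw [Real.sqrt_mul (by positivity), Real.sqrt_inv, Real.sqrt_sq hpos.le, mul_inv, inv_inv,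
        mul_comm]
    · congr 1
      field_simp
      ring
  simp only [key]
  rw [← Finset.prod_mul_distrib]
  have : (∏ n : Fin N, (Real.pi * ((n:ℕ) + 1)) * (Real.sqrt (2 * Real.pi))⁻¹ *
        Real.exp (-((1/2) * ((Real.pi * ((n:ℕ) + 1)) ^ 2 * ab.1 n ^ 2))) *
        ((Real.pi * ((n:ℕ) + 1)) * (Real.sqrt (2 * Real.pi))⁻¹ *
        Real.exp (-((1/2) * ((Real.pi * ((n:ℕ) + 1)) ^ 2 * ab.2 n ^ 2)))))
      = ((2 * Real.pi) ^ N)⁻¹ * (∏ n : Fin N, (Real.pi * ((n : ℕ) + 1)) ^ 2) *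
        Real.exp (-((1/2) * ∑ n : Fin N, (Real.pi * ((n : ℕ) + 1)) ^ 2 *
          ((ab.1 n) ^ 2 + (ab.2 n) ^ 2))) := by
    rw [Finset.mul_sum, ← Finset.sum_neg_distrib, Real.exp_sum, ← inv_pow]
    have hc : (2 * Real.pi)⁻¹ ^ N = ∏ n : Fin N, (2 * Real.pi)⁻¹ := by simp
    rw [hc, ← Finset.prod_mul_distrib, ← Finset.prod_mul_distrib]
    refine Finset.prod_congr rfl fun n _ => ?_
    have hs : (Real.sqrt (2 * Real.pi))⁻¹ * (Real.sqrt (2 * Real.pi))⁻¹ = (2 * Real.pi)⁻¹ := by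
      rw [← mul_inv, Real.mul_self_sqrt (by positivity)]
    rw [← hs]
    rw [show -(1 / 2 * ((Real.pi * (((n:ℕ):ℝ) + 1)) ^ 2 * (ab.1 n ^ 2 + ab.2 n ^ 2))) =
      -(1 / 2 * ((Real.pi * (((n:ℕ):ℝ) + 1)) ^ 2 * ab.1 n ^ 2)) +
      -(1 / 2 * ((Real.pi * (((n:ℕ):ℝ) + 1)) ^ 2 * ab.2 n ^ 2)) by ring, Real.exp_add]
    ring
  rw [this]
  gcongr
  unfold Ham
  have : 0 ≤ (1/(α + 2)) * ∫ x, |wA χ ab.1 x| ^ (α + 2) ∂μΘ := by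
    refine mul_nonneg (by positivity) (integral_nonneg fun x => ?_)
    positivity
  linarith

lemma rho_mgf {N : ℕ} (χ : ℝ → ℝ) (α : ℝ) (hα : 0 < α) (p q : Fin N → ℝ) :
    ∫⁻ ab, ENNReal.ofReal (Real.exp (∑ n, (p n * ab.1 n + q n * ab.2 n))) ∂(rhoN N χ α)
      ≤ ENNReal.ofReal
        (Real.exp ((∑ n : Fin N, (p n ^ 2 + q n ^ 2) / (Real.pi * ((n:ℕ) + 1)) ^ 2) / 2)) := by
  refine (lintegral_mono' (rho_le χ α hα) le_rfl).trans ?_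
  have hm : ∀ v : ℝ≥0, Measurable (ProbabilityTheory.gaussianPDFReal 0 v) :=
    fun v => ProbabilityTheory.measurable_gaussianPDFReal 0 v
  rw [lintegral_withDensity_eq_lintegral_mul _ (by fun_prop) (by fun_prop)]
  have h1 : Integrable (fun a : Fin N → ℝ => ∏ n : Fin N, (ProbabilityTheory.gaussianPDFReal 0 (vr n) (a n)
      * Real.exp (p n * a n))) := Integrable.fintype_prod (fun n : Fin N => gauss1_int n (p n))
  have h2 : Integrable (fun a : Fin N → ℝ => ∏ n : Fin N, (ProbabilityTheory.gaussianPDFReal 0 (vr n) (a n)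
      * Real.exp (q n * a n))) := Integrable.fintype_prod (fun n : Fin N => gauss1_int n (q n))
  have h3 := h1.mul_prod h2
  have h4 := integral_prod_mul (μ := (volume : Measure (Fin N → ℝ)))
    (ν := (volume : Measure (Fin N → ℝ)))
    (fun a : Fin N → ℝ => ∏ n : Fin N, (ProbabilityTheory.gaussianPDFReal 0 (vr n) (a n)
      * Real.exp (p n * a n))) (fun a : Fin N → ℝ => ∏ n : Fin N, (ProbabilityTheory.gaussianPDFReal 0 (vr n) (a n)
      * Real.exp (q n * a n)))
  have e1 := integral_fintype_prod_eq_prod (μ := fun _ : Fin N => (volume : Measure ℝ))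
    (fun (n : Fin N) a => ProbabilityTheory.gaussianPDFReal 0 (vr n) a * Real.exp (p n * a))
  have e2 := integral_fintype_prod_eq_prod (μ := fun _ : Fin N => (volume : Measure ℝ))
    (fun (n : Fin N) a => ProbabilityTheory.gaussianPDFReal 0 (vr n) a * Real.exp (q n * a))
  rw [← volume_pi] at e1 e2
  rw [e1, e2] at h4
  simp only [gauss1_val] at h4
  have h5 := ofReal_integral_eq_lintegral_ofReal h3 (by
    filter_upwards with ab
    refine mul_nonneg (Finset.prod_nonneg fun n _ => ?_) (Finset.prod_nonneg fun n _ => ?_)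
    all_goals exact mul_nonneg (ProbabilityTheory.gaussianPDFReal_nonneg _ _ _) (Real.exp_pos _).le)
  rw [h4] at h5
  have h6 : (Real.exp ((∑ n : Fin N, (p n ^ 2 + q n ^ 2) / (Real.pi * ((n:ℕ) + 1)) ^ 2) / 2)) =
     (∏ x : Fin N, Real.exp (p x ^ 2 / (Real.pi * (((x:ℕ):ℝ) + 1)) ^ 2 / 2)) *
        ∏ x : Fin N, Real.exp (q x ^ 2 / (Real.pi * (((x:ℕ):ℝ) + 1)) ^ 2 / 2) := by
    rw [← Real.exp_sum, ← Real.exp_sum, ← Real.exp_add, ← Finset.sum_add_distrib, Finset.sum_div]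
    congr 1
    refine Finset.sum_congr rfl fun n _ => ?_
    ring
  rw [h6, h5]
  refine le_of_eq ?_
  rw [← Measure.volume_eq_prod]
  refine lintegral_congr fun ab => ?_
  simp only [Pi.mul_apply]
  rw [← ENNReal.ofReal_mul]
  · congr 1
    rw [Finset.prod_mul_distrib, Finset.prod_mul_distrib, Finset.sum_add_distrib, Real.exp_add,
      Real.exp_sum, Real.exp_sum]
    ring
  · refine mul_nonneg (Finset.prod_nonneg fun n _ => ?_) (Finset.prod_nonneg fun n _ => ?_)
    all_goals exact (ProbabilityTheory.gaussianPDFReal_nonneg _ _ _)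

/-- absolute constant `E exp(g²/4)` -/
def A0 : ℝ≥0∞ :=
  ∫⁻ g, ENNReal.ofReal (Real.exp (g ^ 2 / 4)) ∂(ProbabilityTheory.gaussianReal 0 1)

lemma A0_lt_top : A0 < ⊤ := by
  unfold A0
  rw [ProbabilityTheory.gaussianReal_of_var_ne_zero _ one_ne_zero,
    lintegral_withDensity_eq_lintegral_mul _ (ProbabilityTheory.measurable_gaussianPDF _ _)
      (by fun_prop)]
  have h : Integrable (fun g : ℝ => (Real.sqrt (2 * Real.pi))⁻¹ * Real.exp (-(1/4) * g ^ 2)) :=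
    (integrable_exp_neg_mul_sq (by norm_num)).const_mul _
  refine lt_of_eq_of_lt (lintegral_congr fun g => ?_) h.lintegral_lt_top
  simp only [Pi.mul_apply, ProbabilityTheory.gaussianPDF]
  rw [← ENNReal.ofReal_mul (ProbabilityTheory.gaussianPDFReal_nonneg _ _ _)]
  congr 1
  unfold ProbabilityTheory.gaussianPDFReal
  rw [mul_assoc, ← Real.exp_add]
  simp only [NNReal.coe_one, mul_one, sub_zero]
  congr 2
  ring

lemma HS (y : ℝ) : ENNReal.ofReal (Real.exp (y ^ 2 / 2)) =
    ∫⁻ g, ENNReal.ofReal (Real.exp (y * g)) ∂(ProbabilityTheory.gaussianReal 0 1) := by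
  have h := congrFun (ProbabilityTheory.mgf_id_gaussianReal (μ := 0) (v := 1)) y
  simp only [ProbabilityTheory.mgf, id] at h
  rw [← ofReal_integral_eq_lintegral_ofReal
    (ProbabilityTheory.integrable_exp_mul_gaussianReal y) (by
      filter_upwards with g using (Real.exp_pos _).le), h]
  simp

instance rhoN_sfinite (N : ℕ) (χ : ℝ → ℝ) (α : ℝ) : SFinite (rhoN N χ α) := by
  unfold rhoN; infer_instance

lemma rho_exp_real {N : ℕ} (χ : ℝ → ℝ) (α : ℝ) (hα : 0 < α) (κ : ℝ) (hκ : 0 ≤ κ) (p q : Fin N → ℝ)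
    (hv : κ * ∑ n : Fin N, (p n ^ 2 + q n ^ 2) / (Real.pi * ((n:ℕ) + 1)) ^ 2 ≤ 1/4) :
    ∫⁻ ab, ENNReal.ofReal (Real.exp (κ * (∑ n, (p n * ab.1 n + q n * ab.2 n)) ^ 2)) ∂(rhoN N χ α)
      ≤ A0 := by
  have h1 : ∀ ab : (Fin N → ℝ) × (Fin N → ℝ),
      ENNReal.ofReal (Real.exp (κ * (∑ n, (p n * ab.1 n + q n * ab.2 n)) ^ 2))
      = ∫⁻ g, ENNReal.ofReal (Real.exp (∑ n, ((Real.sqrt (2 * κ) * g * p n) * ab.1 n +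
        (Real.sqrt (2 * κ) * g * q n) * ab.2 n))) ∂(ProbabilityTheory.gaussianReal 0 1) := by
    intro ab
    have := HS (Real.sqrt (2 * κ) * (∑ n, (p n * ab.1 n + q n * ab.2 n)))
    rw [mul_pow, Real.sq_sqrt (by positivity)] at this
    rw [show κ * (∑ n, (p n * ab.1 n + q n * ab.2 n)) ^ 2 =
      2 * κ * (∑ n, (p n * ab.1 n + q n * ab.2 n)) ^ 2 / 2 by ring, this]
    refine lintegral_congr fun g => ?_
    congr 2
    rw [Finset.mul_sum, Finset.sum_mul]
    refine Finset.sum_congr rfl fun n _ => ?_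
    ring
  simp only [h1]
  rw [lintegral_lintegral_swap (by fun_prop)]
  unfold A0
  refine lintegral_mono fun g => ?_
  refine (rho_mgf χ α hα _ _).trans ?_
  refine ENNReal.ofReal_le_ofReal (Real.exp_le_exp.2 ?_)
  have : ∑ n : Fin N, ((Real.sqrt (2 * κ) * g * p n) ^ 2 + (Real.sqrt (2 * κ) * g * q n) ^ 2) /
      (Real.pi * ((n:ℕ) + 1)) ^ 2 = (2 * g ^ 2) * (κ * ∑ n : Fin N, (p n ^ 2 + q n ^ 2) /
      (Real.pi * ((n:ℕ) + 1)) ^ 2) := by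
    rw [Finset.mul_sum, Finset.mul_sum]
    refine Finset.sum_congr rfl fun n _ => ?_
    rw [mul_pow, mul_pow, mul_pow, mul_pow, Real.sq_sqrt (by positivity)]
    ring
  rw [this]
  nlinarith [sq_nonneg g, mul_le_mul_of_nonneg_left hv (sq_nonneg g)]

lemma rho_exp {N : ℕ} (χ : ℝ → ℝ) (α : ℝ) (hα : 0 < α) (c : ℝ) (hc : 0 ≤ c) (β : Fin N → ℂ)
    (hv : c * ∑ n : Fin N, ‖β n‖ ^ 2 / (Real.pi * ((n:ℕ) + 1)) ^ 2 ≤ 1/8) :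
    ∫⁻ ab, ENNReal.ofReal (Real.exp (c * ‖∑ n, β n * ((ab.1 n : ℂ) + (ab.2 n : ℂ) * Complex.I)‖ ^ 2))
      ∂(rhoN N χ α) ≤ 2 * A0 := by
  have hβ : ∀ n, ‖β n‖ ^ 2 = (β n).re ^ 2 + (β n).im ^ 2 := by
    intro n; rw [Complex.sq_norm, Complex.normSq_apply]; ring
  have i1 := rho_exp_real χ α hα (2 * c) (by positivity) (fun n => (β n).re) (fun n => -(β n).im) (by
    simp only [neg_sq, ← hβ]; linarith)
  have i2 := rho_exp_real χ α hα (2 * c) (by positivity) (fun n => (β n).im) (fun n => (β n).re) (by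
    simp only [add_comm ((β _).im ^ 2), ← hβ]; linarith)
  rw [two_mul]
  refine le_trans ?_ (add_le_add i1 i2)
  rw [← lintegral_add_left (by fun_prop)]
  refine lintegral_mono fun ab => ?_
  rw [← ENNReal.ofReal_add (Real.exp_pos _).le (Real.exp_pos _).le]
  refine ENNReal.ofReal_le_ofReal ?_
  set S := ∑ n, β n * ((ab.1 n : ℂ) + (ab.2 n : ℂ) * Complex.I)
  have hre : S.re = ∑ n, ((β n).re * ab.1 n + -(β n).im * ab.2 n) := by
    simp only [S, Complex.re_sum]
    refine Finset.sum_congr rfl fun n _ => ?_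
    simp; ring
  have him : S.im = ∑ n, ((β n).im * ab.1 n + (β n).re * ab.2 n) := by
    simp only [S, Complex.im_sum]
    refine Finset.sum_congr rfl fun n _ => ?_
    simp; ring
  rw [← hre, ← him, Complex.sq_norm, Complex.normSq_apply]
  rcases le_total (S.re ^ 2) (S.im ^ 2) with h | h
  · have : Real.exp (c * (S.re * S.re + S.im * S.im)) ≤ Real.exp (2 * c * S.im ^ 2) := by
      refine Real.exp_le_exp.2 ?_
      nlinarith
    have := Real.exp_pos (2 * c * S.re ^ 2)
    linarith
  · have : Real.exp (c * (S.re * S.re + S.im * S.im)) ≤ Real.exp (2 * c * S.re ^ 2) := by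
      refine Real.exp_le_exp.2 ?_
      nlinarith
    have := Real.exp_pos (2 * c * S.im ^ 2)
    linarith

end

section

lemma cont_nl {α : ℝ} (hα : 0 < α) : Continuous (fun z : ℝ => |z| ^ α * z) :=
  (continuous_abs.rpow_const (fun _ => Or.inr hα.le)).mul continuous_id

lemma hasDerivAt_nl {α : ℝ} (hα : 0 < α) (z : ℝ) :
    HasDerivAt (fun z : ℝ => |z| ^ α * z) ((α + 1) * |z| ^ α) z := by
  rcases lt_trichotomy z 0 with h | h | h
  · have h1 : HasDerivAt (fun z : ℝ => (-z) ^ α * z) ((α + 1) * |z| ^ α) z := by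
      have := (((hasDerivAt_id z).neg).rpow_const (p := α) (Or.inl (by simpa using h.ne))).mul
        (hasDerivAt_id z)
      convert! this using 1
      simp only [Pi.neg_apply, id]
      rw [abs_of_neg h, Real.rpow_sub_one (by linarith)]
      have hz : z ≠ 0 := h.ne
      field_simp
    refine h1.congr_of_eventuallyEq ?_
    filter_upwards [Iio_mem_nhds h] with y hy
    rw [abs_of_neg hy]
  · subst h
    rw [hasDerivAt_iff_isLittleO_nhds_zero]
    simp only [zero_add, abs_zero, mul_zero, sub_zero, Real.zero_rpow hα.ne', smul_zero]
    have : (fun h : ℝ => |h| ^ α * h) =o[nhds 0] fun h : ℝ => (1:ℝ) * h := by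
      refine Asymptotics.IsLittleO.mul_isBigO ?_ (Asymptotics.isBigO_refl _ _)
      rw [Asymptotics.isLittleO_one_iff]
      have := (continuous_abs.rpow_const (f := fun x : ℝ => |x|) (p := α)
        (fun _ => Or.inr hα.le)).tendsto 0
      simpa [Real.zero_rpow hα.ne'] using this
    simpa using this
  · have h1 : HasDerivAt (fun z : ℝ => z ^ α * z) ((α + 1) * |z| ^ α) z := by
      have := ((hasDerivAt_id z).rpow_const (p := α) (Or.inl (by simpa using h.ne'))).mul
        (hasDerivAt_id z)
      convert! this using 1
      simp only [id]
      rw [abs_of_pos h, Real.rpow_sub_one (by linarith)]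
      field_simp
    refine h1.congr_of_eventuallyEq ?_
    filter_upwards [Ioi_mem_nhds h] with y hy
    rw [abs_of_pos hy]

lemma lip_nl {α : ℝ} (hα : 0 < α) {R z z' : ℝ} (hz : |z| ≤ R) (hz' : |z'| ≤ R) :
    |(|z| ^ α * z) - |z'| ^ α * z'| ≤ (α + 1) * R ^ α * |z - z'| := by
  have := Convex.norm_image_sub_le_of_norm_hasDerivWithin_le (𝕜 := ℝ)
    (f := fun z : ℝ => |z| ^ α * z) (f' := fun z => (α + 1) * |z| ^ α) (s := Icc (-R) R)
    (C := (α + 1) * R ^ α) (fun x _ => (hasDerivAt_nl hα x).hasDerivWithinAt)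
    (fun x hx => by
      rw [Real.norm_eq_abs, abs_of_nonneg (by positivity)]
      have := abs_le.2 hx
      gcongr) (convex_Icc _ _) (abs_le.1 hz') (abs_le.1 hz)
  simpa using this

variable {N : ℕ}

/-- crude size constant of `wA` -/
def KN (N : ℕ) (χ : ℝ → ℝ) : ℝ :=
  ∑ m : Fin N, |χ (((m : ℕ) + 1 : ℝ) ^ 2 / (N : ℝ) ^ 2)| * (((m:ℕ) + 1 : ℝ) * Real.pi)

lemma KN_nonneg (χ : ℝ → ℝ) : 0 ≤ KN N χ := Finset.sum_nonneg fun m _ => by positivity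

lemma wA_bound (χ : ℝ → ℝ) (a : Fin N → ℝ) (x : E3) : |wA χ a x| ≤ KN N χ * ‖a‖ := by
  unfold wA KN
  refine (Finset.abs_sum_le_sum_abs _ _).trans ?_
  rw [Finset.sum_mul]
  refine Finset.sum_le_sum fun m _ => ?_
  rw [abs_mul, abs_mul]
  have h1 := abs_eFun_le ((m:ℕ)+1) x
  have h2 := norm_le_pi_norm a m
  rw [Real.norm_eq_abs] at h2
  push_cast at h1
  calc _ ≤ |χ (((m : ℕ) + 1 : ℝ) ^ 2 / (N : ℝ) ^ 2)| * ‖a‖ * (((m:ℕ) + 1 : ℝ) * Real.pi) := by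
        gcongr
    _ = _ := by ring

lemma wA_sub (χ : ℝ → ℝ) (a a' : Fin N → ℝ) (x : E3) :
    wA χ a x - wA χ a' x = wA χ (a - a') x := by
  unfold wA
  rw [← Finset.sum_sub_distrib]
  refine Finset.sum_congr rfl fun m _ => ?_
  simp; ring

lemma measurable_wA_uncurry (χ : ℝ → ℝ) :
    Measurable (fun z : (Fin N → ℝ) × E3 => wA χ z.1 z.2) := by
  unfold wA
  have := measurable_eFun
  fun_prop

lemma measurable_wA (χ : ℝ → ℝ) (a : Fin N → ℝ) : Measurable (wA χ a) :=
  (measurable_wA_uncurry χ).comp (by fun_prop : Measurable fun x : E3 => (a, x))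

lemma continuous_wA (χ : ℝ → ℝ) (x : E3) : Continuous (fun a : Fin N → ℝ => wA χ a x) := by
  unfold wA
  fun_prop

lemma cont_int (χ : ℝ → ℝ) {φ : ℝ → ℝ} (hφ : Continuous φ) {g : E3 → ℝ} (hg : Measurable g)
    {B : ℝ} (hB : ∀ x, |g x| ≤ B) :
    Continuous (fun a : Fin N → ℝ => ∫ x, φ (wA χ a x) * g x ∂μΘ) := by
  rw [continuous_iff_continuousAt]
  intro a0
  obtain ⟨K, hK⟩ := (isCompact_Icc (a := -(KN N χ * (‖a0‖ + 1))) (b := KN N χ * (‖a0‖ + 1))).exists_bound_of_continuousOn hφ.continuousOn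
  have hB0 : 0 ≤ B := (abs_nonneg _).trans (hB 0)
  refine continuousAt_of_dominated (bound := fun _ => K * B) ?_ ?_ (integrable_const _) ?_
  · filter_upwards with a
    exact ((hφ.measurable.comp (measurable_wA χ a)).mul hg).aestronglyMeasurable
  · have : ∀ᶠ a in nhds a0, ‖a‖ < ‖a0‖ + 1 :=
      continuous_norm.continuousAt.eventually (Iio_mem_nhds (by linarith))
    filter_upwards [this] with a ha
    filter_upwards with x
    rw [norm_mul]
    have h1 : |wA χ a x| ≤ KN N χ * (‖a0‖ + 1) :=
      (wA_bound χ a x).trans (by have := KN_nonneg (N := N) χ; gcongr)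
    have h2 := hK _ (abs_le.1 h1)
    exact mul_le_mul h2 (hB x) (norm_nonneg _) ((norm_nonneg _).trans h2)
  · filter_upwards with x
    exact ((hφ.comp (continuous_wA χ x)).mul continuous_const).continuousAt

/-- the nonlinear force -/
def Gf (χ : ℝ → ℝ) (α : ℝ) (a : Fin N → ℝ) (n : Fin N) : ℝ :=
  (Real.pi * ((n : ℕ) + 1))⁻¹ * χ (((n : ℕ) + 1 : ℝ) ^ 2 / (N : ℝ) ^ 2) *
            ∫ y, |wA χ a y| ^ α * wA χ a y * eFun ((n : ℕ) + 1) y ∂μΘ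

lemma continuous_I (χ : ℝ → ℝ) {α : ℝ} (hα : 0 < α) (n : ℕ) :
    Continuous (fun a : Fin N → ℝ => ∫ y, |wA χ a y| ^ α * wA χ a y * eFun n y ∂μΘ) :=
  cont_int χ (cont_nl hα) (measurable_eFun n) (abs_eFun_le n)

lemma integrable_I (χ : ℝ → ℝ) {α : ℝ} (hα : 0 < α) (n : ℕ) (a : Fin N → ℝ) :
    Integrable (fun y => |wA χ a y| ^ α * wA χ a y * eFun n y) μΘ := by
  refine Integrable.of_bound (C := (KN N χ * ‖a‖) ^ α * (KN N χ * ‖a‖) * (n * Real.pi)) ?_ ?_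
  · exact (((cont_nl hα).measurable.comp (measurable_wA χ a)).mul
      (measurable_eFun n)).aestronglyMeasurable
  · filter_upwards with x
    rw [norm_mul, norm_mul, Real.norm_eq_abs, Real.norm_eq_abs, Real.norm_eq_abs,
      abs_of_nonneg (by positivity : 0 ≤ |wA χ a x| ^ α)]
    have := wA_bound χ a x
    have h2 := abs_eFun_le n x
    have h0 := (abs_nonneg _).trans this
    gcongr

lemma continuous_Gf (χ : ℝ → ℝ) {α : ℝ} (hα : 0 < α) : Continuous (Gf (N := N) χ α) := by
  refine continuous_pi fun n => ?_
  exact continuous_const.mul (continuous_I χ hα _)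

lemma lip_Gf (χ : ℝ → ℝ) {α : ℝ} (hα : 0 < α) (R : ℝ) : ∃ L, 0 ≤ L ∧ ∀ a a' : Fin N → ℝ,
    ‖a‖ ≤ R → ‖a'‖ ≤ R → ‖Gf χ α a - Gf χ α a'‖ ≤ L * ‖a - a'‖ := by
  by_cases hR : R < 0
  · exact ⟨0, le_rfl, fun a _ ha _ => absurd (norm_nonneg a) (by linarith)⟩
  push Not at hR
  have hK := KN_nonneg (N := N) χ
  set D : ℝ := (α + 1) * (KN N χ * R) ^ α * KN N χ with hD
  have hD0 : 0 ≤ D := by positivity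
  set L : Fin N → ℝ := fun n => |(Real.pi * ((n : ℕ) + 1))⁻¹ * χ (((n : ℕ) + 1 : ℝ) ^ 2 / (N : ℝ) ^ 2)| *
    (D * (((n:ℕ) + 1 : ℕ) * Real.pi) * μΘ.real univ) with hL
  have hLn : ∀ n, 0 ≤ L n := fun n => by positivity
  refine ⟨∑ n, L n, Finset.sum_nonneg fun n _ => hLn n, fun a a' ha ha' => ?_⟩
  refine (pi_norm_le_iff_of_nonneg (by have := Finset.sum_nonneg fun n (_ : n ∈ Finset.univ) => hLn n; positivity)).2 fun n => ?_
  refine le_trans ?_ (mul_le_mul_of_nonneg_right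
    (Finset.single_le_sum (fun n _ => hLn n) (Finset.mem_univ n)) (norm_nonneg _))
  simp only [Pi.sub_apply, Gf]
  rw [← mul_sub, ← integral_sub (integrable_I χ hα _ a) (integrable_I χ hα _ a'), norm_mul,
    Real.norm_eq_abs]
  rw [hL]
  simp only
  rw [mul_assoc]
  refine mul_le_mul_of_nonneg_left ?_ (abs_nonneg _)
  have := norm_integral_le_of_norm_le_const (μ := μΘ)
    (f := fun y => |wA χ a y| ^ α * wA χ a y * eFun ((n : ℕ) + 1) y -
      |wA χ a' y| ^ α * wA χ a' y * eFun ((n : ℕ) + 1) y)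
    (C := D * ‖a - a'‖ * (((n:ℕ) + 1 : ℕ) * Real.pi)) (by
      filter_upwards with y
      rw [← sub_mul, norm_mul, Real.norm_eq_abs, Real.norm_eq_abs]
      refine mul_le_mul ?_ (abs_eFun_le _ _) (abs_nonneg _) (by positivity)
      have h1 : |wA χ a y| ≤ KN N χ * R := (wA_bound χ a y).trans (by gcongr)
      have h2 : |wA χ a' y| ≤ KN N χ * R := (wA_bound χ a' y).trans (by gcongr)
      refine (lip_nl hα h1 h2).trans ?_
      rw [wA_sub, hD, mul_assoc _ (KN N χ) ‖a - a'‖]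
      refine mul_le_mul_of_nonneg_left (wA_bound _ _ _) (by positivity))
  refine this.trans (le_of_eq ?_)
  ring

lemma continuous_Ham (χ : ℝ → ℝ) {α : ℝ} (hα : 0 < α) : Continuous (Ham (N := N) χ α) := by
  unfold Ham
  have h := cont_int (N := N) χ (φ := fun z => |z| ^ (α + 2))
    (continuous_abs.rpow_const (fun _ => Or.inr (by linarith))) (g := fun _ => 1)
    measurable_const (B := 1) (by simp)
  simp only [mul_one] at h
  have := h.comp (continuous_fst (X := Fin N → ℝ) (Y := Fin N → ℝ))
  simp only [Function.comp_def] at this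
  fun_prop

end

section

lemma euler_conv_pos {E : Type*} [NormedAddCommGroup E] [NormedSpace ℝ E] (F : ℝ → E → E)
    (hF : Continuous (Function.uncurry F))
    (hL : ∀ R : ℝ, ∃ L, 0 ≤ L ∧ ∀ h ∈ Icc (-1:ℝ) 1, ∀ x y, ‖x‖ ≤ R → ‖y‖ ≤ R →
      ‖F h x - F h y‖ ≤ L * ‖x - y‖)
    (y : ℝ → E) (hy : ∀ t, HasDerivAt y (F 0 (y t)) t) (T : ℝ) (hT : 0 ≤ T) :
    Filter.Tendsto (fun k : ℕ => ((fun x => x + (T / k) • F (T / k) x)^[k]) (y 0)) Filter.atTop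
      (nhds (y T)) := by
  have hyc : Continuous y := continuous_iff_continuousAt.2 fun t => (hy t).continuousAt
  obtain ⟨R, hR⟩ := (isCompact_Icc (a := (0:ℝ)) (b := T)).exists_bound_of_continuousOn
    hyc.continuousOn
  obtain ⟨L, hL0, hL⟩ := hL (R + 1)
  rw [Metric.tendsto_atTop]
  intro ε hε
  have hexp := Real.exp_pos (L * T)
  set η : ℝ := min 1 (ε / 2) / ((T + 1) * Real.exp (L * T)) with hη
  have hη0 : 0 < η := by positivity
  -- consistency
  have hq : Continuous (fun z : ℝ × ℝ => F z.1 (y z.2)) :=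
    hF.comp (continuous_fst.prodMk (hyc.comp continuous_snd))
  have hu := (isCompact_Icc (a := (-1:ℝ)) (b := 1)).prod (isCompact_Icc (a := (0:ℝ)) (b := T))
    |>.uniformContinuousOn_of_continuous hq.continuousOn
  rw [Metric.uniformContinuousOn_iff] at hu
  obtain ⟨δ, hδ, hu⟩ := hu η hη0
  obtain ⟨k0, hk0⟩ := exists_nat_gt (max (T + 1) (T / δ))
  refine ⟨k0, fun k hk => ?_⟩
  have hkk : max (T + 1) (T / δ) < (k:ℝ) := hk0.trans_le (by exact_mod_cast hk)
  have hk1 : T + 1 < k := (le_max_left _ _).trans_lt hkk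
  have hk2 : T / δ < k := (le_max_right _ _).trans_lt hkk
  have hkpos : (0:ℝ) < k := by linarith
  set h : ℝ := T / k with hh
  have hh0 : 0 ≤ h := by positivity
  have hh1 : h ≤ 1 := by rw [hh, div_le_one hkpos]; linarith
  have hhδ : h < δ := by
    rw [hh, div_lt_iff₀ hkpos]
    rw [div_lt_iff₀ hδ] at hk2
    linarith
  have hkh : k * h = T := by rw [hh]; field_simp
  have cons : ∀ t0, 0 ≤ t0 → t0 + h ≤ T → ‖y (t0 + h) - y t0 - h • F h (y t0)‖ ≤ η * h := by
    intro t0 ht0 ht1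
    have := Convex.norm_image_sub_le_of_norm_hasDerivWithin_le (𝕜 := ℝ)
      (f := fun s => y s - s • F h (y t0)) (f' := fun s => F 0 (y s) - F h (y t0))
      (s := Icc t0 (t0 + h)) (C := η) (fun s _ => by
        have h1 := (hy s).sub ((hasDerivAt_id s).smul_const (F h (y t0)))
        simp only [one_smul] at h1
        exact h1.hasDerivWithinAt) (fun s hs => by
        have := hu (0, s) ⟨by simp, ⟨by linarith [hs.1], by linarith [hs.2]⟩⟩ (h, t0)
          ⟨⟨by linarith, hh1⟩, ⟨ht0, by linarith⟩⟩ (by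
            rw [Prod.dist_eq, max_lt_iff, Real.dist_eq, Real.dist_eq]
            constructor
            · simpa [abs_of_nonneg hh0] using hhδ
            · simp only
              rw [abs_of_nonneg (by linarith [hs.1])]
              linarith [hs.2])
        rw [dist_eq_norm] at this
        exact this.le) (convex_Icc _ _) (left_mem_Icc.2 (by linarith)) (right_mem_Icc.2 (by linarith))
    have e1 : (y (t0 + h) - (t0 + h) • F h (y t0)) - (y t0 - t0 • F h (y t0))
        = y (t0 + h) - y t0 - h • F h (y t0) := by
      rw [add_smul]; abel
    rw [e1] at this
    simpa [abs_of_nonneg hh0] using this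
  set Ψ : E → E := fun x => x + h • F h x with hΨ
  have main : ∀ j : ℕ, j ≤ k → ‖(Ψ^[j]) (y 0) - y (j * h)‖ ≤ η * (j * h) * (1 + h * L) ^ j := by
    intro j
    induction j with
    | zero => intro _; simp
    | succ j ih =>
      intro hj
      have ih := ih (by omega)
      have hjk : (j:ℝ) + 1 ≤ k := by exact_mod_cast hj
      have hjT : (j:ℝ) * h + h ≤ T := by nlinarith
      have hj0 : 0 ≤ (j:ℝ) * h := by positivity
      have hpow : (1 + h * L) ^ j ≤ Real.exp (L * T) := by
        have h1 : 1 + h * L ≤ Real.exp (h * L) := by linarith [Real.add_one_le_exp (h * L)]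
        calc (1 + h * L) ^ j ≤ (Real.exp (h * L)) ^ j := by gcongr
          _ = Real.exp (j * (h * L)) := by rw [Real.exp_nat_mul]
          _ ≤ _ := by
            refine Real.exp_le_exp.2 ?_
            nlinarith
      have hle1 : η * (j * h) * (1 + h * L) ^ j ≤ min 1 (ε / 2) := by
        calc η * (j * h) * (1 + h * L) ^ j ≤ η * (T + 1) * Real.exp (L * T) := by
              gcongr; linarith
          _ = _ := by rw [hη]; field_simp
      have hy1 : ‖y (j * h)‖ ≤ R := hR _ ⟨hj0, by linarith⟩
      have hx1 : ‖(Ψ^[j]) (y 0)‖ ≤ R + 1 := by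
        have := norm_le_norm_add_norm_sub' ((Ψ^[j]) (y 0)) (y (j * h))
        have h2 := ih.trans (hle1.trans (min_le_left _ _))
        linarith
      rw [Function.iterate_succ_apply']
      set x := (Ψ^[j]) (y 0) with hx
      have c1 := cons (j * h) hj0 hjT
      have c2 := hL h ⟨by linarith, hh1⟩ x (y (j * h)) hx1 (by linarith)
      have e1 : Ψ x - y ((j + 1 : ℕ) * h) = (x - y (j * h)) + h • (F h x - F h (y (j * h)))
          - (y (j * h + h) - y (j * h) - h • F h (y (j * h))) := by
        have : ((j + 1 : ℕ) : ℝ) * h = j * h + h := by push_cast; ring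
        rw [this, hΨ]
        simp only [smul_sub]
        abel
      rw [e1]
      refine (norm_sub_le _ _).trans ((add_le_add (norm_add_le _ _) c1).trans ?_)
      rw [norm_smul, Real.norm_eq_abs, abs_of_nonneg hh0]
      push_cast
      have hp1 : 1 ≤ (1 + h * L) ^ (j + 1) := one_le_pow₀ (by nlinarith)
      have := mul_le_mul_of_nonneg_left c2 hh0
      have h3 : (1 + h * L) * ‖x - y (j * h)‖ ≤ (1 + h * L) * (η * (j * h) * (1 + h * L) ^ j) := by
        gcongr
      have h4 : η * h * 1 ≤ η * h * (1 + h * L) ^ (j + 1) := by gcongr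
      have h5 : η * ((j + 1) * h) * (1 + h * L) ^ (j + 1) =
        (1 + h * L) * (η * (j * h) * (1 + h * L) ^ j) + η * h * (1 + h * L) ^ (j + 1) := by ring
      rw [h5]
      nlinarith
  have hm := main k le_rfl
  rw [hkh] at hm
  rw [dist_eq_norm]
  refine hm.trans_lt ?_
  have hpow : (1 + h * L) ^ k ≤ Real.exp (L * T) := by
    have h1 : 1 + h * L ≤ Real.exp (h * L) := by linarith [Real.add_one_le_exp (h * L)]
    calc (1 + h * L) ^ k ≤ (Real.exp (h * L)) ^ k := by gcongr
      _ = Real.exp (k * (h * L)) := by rw [Real.exp_nat_mul]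
      _ ≤ _ := by
        refine Real.exp_le_exp.2 ?_
        rw [← mul_assoc, hkh, mul_comm]
  calc η * T * (1 + h * L) ^ k ≤ η * (T + 1) * Real.exp (L * T) := by
        gcongr; linarith
    _ = min 1 (ε / 2) := by rw [hη]; field_simp
    _ ≤ ε / 2 := min_le_right _ _
    _ < ε := by linarith

lemma euler_conv {E : Type*} [NormedAddCommGroup E] [NormedSpace ℝ E] (F : ℝ → E → E)
    (hF : Continuous (Function.uncurry F))
    (hL : ∀ R : ℝ, ∃ L, 0 ≤ L ∧ ∀ h ∈ Icc (-1:ℝ) 1, ∀ x y, ‖x‖ ≤ R → ‖y‖ ≤ R →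
      ‖F h x - F h y‖ ≤ L * ‖x - y‖)
    (y : ℝ → E) (hy : ∀ t, HasDerivAt y (F 0 (y t)) t) (T : ℝ) :
    Filter.Tendsto (fun k : ℕ => ((fun x => x + (T / k) • F (T / k) x)^[k]) (y 0)) Filter.atTop
      (nhds (y T)) := by
  rcases le_total 0 T with hT | hT
  · exact euler_conv_pos F hF hL y hy T hT
  have := euler_conv_pos (fun h x => - F (-h) x) ?_ ?_ (fun t => y (-t)) ?_ (-T) (by linarith)
  · simpa [neg_div] using this
  · have : Continuous (fun z : ℝ × E => - Function.uncurry F (-z.1, z.2)) := by fun_prop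
    exact this
  · intro R
    obtain ⟨L, h0, h⟩ := hL R
    refine ⟨L, h0, fun t ht x y hx hy => ?_⟩
    rw [← norm_neg]
    have := h (-t) ⟨by linarith [ht.2], by linarith [ht.1]⟩ x y hx hy
    convert! this using 2
    abel
  · intro t
    have := HasDerivAt.scomp t (hy (-t)) (hasDerivAt_neg t)
    simpa [Function.comp_def] using this

end

section

abbrev XN (N : ℕ) := (Fin N → ℝ) × (Fin N → ℝ)

/-- flow of the truncated system -/
def IsFlow {N : ℕ} (χ : ℝ → ℝ) (α : ℝ) (φ : ℝ → XN N → XN N) : Prop :=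
  (∀ x, φ 0 x = x) ∧ ∀ (x : XN N) (t : ℝ) (n : Fin N),
      HasDerivAt (fun u => (φ u x).1 n) (Real.pi * ((n : ℕ) + 1) * (φ t x).2 n) t ∧
      HasDerivAt (fun u => (φ u x).2 n)
        (-(Real.pi * ((n : ℕ) + 1)) * (φ t x).1 n - Gf χ α (φ t x).1 n) t

def Dm {N : ℕ} (a : Fin N → ℝ) (n : Fin N) : ℝ := Real.pi * ((n : ℕ) + 1) * a n

lemma continuous_Dm {N : ℕ} : Continuous (Dm (N := N)) := by
  unfold Dm; fun_prop

lemma Dm_sub {N : ℕ} (a b : Fin N → ℝ) : Dm a - Dm b = Dm (a - b) := by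
  ext n; simp [Dm]; ring

lemma norm_Dm {N : ℕ} (a : Fin N → ℝ) : ‖Dm a‖ ≤ Real.pi * (N + 1) * ‖a‖ := by
  rw [pi_norm_le_iff_of_nonneg (by positivity)]
  intro n
  unfold Dm
  rw [norm_mul, Real.norm_of_nonneg (by positivity)]
  have h1 : ((n:ℕ):ℝ) ≤ N := by exact_mod_cast n.2.le
  gcongr
  exact norm_le_pi_norm a n

def Fs {N : ℕ} (χ : ℝ → ℝ) (α : ℝ) (h : ℝ) (x : XN N) : XN N :=
  (Dm x.2, -Dm (x.1 + h • Dm x.2) - Gf χ α (x.1 + h • Dm x.2))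

lemma continuous_Fs {N : ℕ} (χ : ℝ → ℝ) {α : ℝ} (hα : 0 < α) :
    Continuous (Function.uncurry (Fs (N := N) χ α)) := by
  have h1 := continuous_Dm (N := N)
  have h2 := continuous_Gf (N := N) χ hα
  unfold Fs Function.uncurry
  fun_prop

lemma lip_Fs {N : ℕ} (χ : ℝ → ℝ) {α : ℝ} (hα : 0 < α) (R : ℝ) :
    ∃ L, 0 ≤ L ∧ ∀ h ∈ Icc (-1:ℝ) 1, ∀ x y : XN N, ‖x‖ ≤ R → ‖y‖ ≤ R →
      ‖Fs χ α h x - Fs χ α h y‖ ≤ L * ‖x - y‖ := by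
  set K : ℝ := Real.pi * (N + 1) with hK
  have hK0 : 0 ≤ K := by positivity
  obtain ⟨L, hL0, hL⟩ := lip_Gf (N := N) χ hα (R + K * R)
  refine ⟨K + (K + L) * (1 + K), by positivity, ?_⟩
  intro h hh x y hx hy
  have habs : |h| ≤ 1 := abs_le.2 hh
  have hb : ∀ x : XN N, ∀ r, ‖x‖ ≤ r → ‖x.1 + h • Dm x.2‖ ≤ r + K * r := by
    intro x r hx
    have h1 := (norm_fst_le x).trans hx
    have h2 := (norm_snd_le x).trans hx
    refine (norm_add_le _ _).trans (add_le_add h1 ?_)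
    rw [norm_smul]
    calc ‖h‖ * ‖Dm x.2‖ ≤ 1 * (K * ‖x.2‖) := by
          gcongr
          · exact habs
          · exact norm_Dm _
      _ ≤ K * r := by rw [one_mul]; gcongr
  have hd := hb (x - y) _ le_rfl
  have hd2 : (x - y).1 + h • Dm (x - y).2 = (x.1 + h • Dm x.2) - (y.1 + h • Dm y.2) := by
    rw [Prod.snd_sub, ← Dm_sub, Prod.fst_sub, smul_sub]; abel
  rw [hd2] at hd
  have hd0 := norm_nonneg (x - y)
  rw [Prod.norm_def]
  refine max_le ?_ ?_
  · change ‖Dm x.2 - Dm y.2‖ ≤ _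
    rw [Dm_sub]
    refine (norm_Dm _).trans ?_
    have : ‖x.2 - y.2‖ ≤ ‖x - y‖ := norm_snd_le (x - y)
    calc K * ‖x.2 - y.2‖ ≤ K * ‖x - y‖ := by gcongr
      _ ≤ _ := by
        gcongr
        nlinarith
  · change ‖(-Dm (x.1 + h • Dm x.2) - Gf χ α (x.1 + h • Dm x.2)) - (-Dm (y.1 + h • Dm y.2) - Gf χ α (y.1 + h • Dm y.2))‖ ≤ _
    have e : (-Dm (x.1 + h • Dm x.2) - Gf χ α (x.1 + h • Dm x.2)) - (-Dm (y.1 + h • Dm y.2) - Gf χ α (y.1 + h • Dm y.2))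
      = -(Dm (x.1 + h • Dm x.2) - Dm (y.1 + h • Dm y.2)) - (Gf χ α (x.1 + h • Dm x.2) - Gf χ α (y.1 + h • Dm y.2)) := by abel
    rw [e]
    refine (norm_sub_le _ _).trans ?_
    rw [norm_neg, Dm_sub]
    have h1 := norm_Dm ((x.1 + h • Dm x.2) - (y.1 + h • Dm y.2))
    have h2 := hL _ _ (hb x R hx) (hb y R hy)
    rw [← hK] at h1
    have h3 : (K + L) * ‖x.1 + h • Dm x.2 - (y.1 + h • Dm y.2)‖ ≤ (K + L) * (‖x - y‖ + K * ‖x - y‖) := by gcongr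
    nlinarith

lemma mp_shear {N : ℕ} {g : (Fin N → ℝ) → (Fin N → ℝ)} (hg : Continuous g) :
    MeasurePreserving (fun x : XN N => (x.1, x.2 + g x.1)) := by
  have := (MeasurePreserving.id (volume : Measure (Fin N → ℝ))).skew_product
    (μc := (volume : Measure (Fin N → ℝ))) (μd := (volume : Measure (Fin N → ℝ)))
    (g := fun a b => b + g a)
    (by have := hg.measurable; unfold Function.uncurry; fun_prop)
    (Filter.Eventually.of_forall fun a => map_add_right_eq_self _ _)
  exact this

lemma mp_shear' {N : ℕ} {g : (Fin N → ℝ) → (Fin N → ℝ)} (hg : Continuous g) :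
    MeasurePreserving (fun x : XN N => (x.1 + g x.2, x.2)) := by
  have hs : MeasurePreserving (Prod.swap : XN N → XN N) := Measure.measurePreserving_swap
  exact (hs.comp (mp_shear hg)).comp hs

lemma mp_step {N : ℕ} (χ : ℝ → ℝ) {α : ℝ} (hα : 0 < α) (h : ℝ) :
    MeasurePreserving (fun x : XN N => x + h • Fs χ α h x) := by
  have h1 := mp_shear' (N := N) (g := fun b => h • Dm b) (continuous_Dm.const_smul h)
  have h2 := mp_shear (N := N) (g := fun a => h • (- Dm a - Gf χ α a))
    ((continuous_Dm.neg.sub (continuous_Gf χ hα)).const_smul h)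
  exact h2.comp h1

section
variable {N : ℕ} {χ : ℝ → ℝ} {α : ℝ} {φ : ℝ → XN N → XN N}

lemma flow_deriv (hφ : IsFlow χ α φ) (x : XN N) (t : ℝ) :
    HasDerivAt (fun s => φ s x) (Fs χ α 0 (φ t x)) t := by
  have h1 : HasDerivAt (fun s => (φ s x).1) (Dm (φ t x).2) t :=
    hasDerivAt_pi.2 fun n => (hφ.2 x t n).1
  have h2 : HasDerivAt (fun s => (φ s x).2) (-Dm (φ t x).1 - Gf χ α (φ t x).1) t := by
    refine hasDerivAt_pi.2 fun n => ?_
    convert! (hφ.2 x t n).2 using 1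
    simp [Dm]
  have := h1.prodMk h2
  simpa [Fs] using this

lemma flow_cont (hφ : IsFlow χ α φ) (x : XN N) : Continuous (fun s => φ s x) :=
  continuous_iff_continuousAt.2 fun t => (flow_deriv hφ x t).continuousAt

def stepk (χ : ℝ → ℝ) (α T : ℝ) (k : ℕ) : XN N → XN N :=
  (fun x => x + (T / k) • Fs χ α (T / k) x)^[k]

lemma mp_stepk (hα : 0 < α) (T : ℝ) (k : ℕ) : MeasurePreserving (stepk (N := N) χ α T k) :=
  (mp_step χ hα _).iterate k

lemma tendsto_stepk (hα : 0 < α) (hφ : IsFlow χ α φ) (T : ℝ) (x : XN N) :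
    Filter.Tendsto (fun k => stepk χ α T k x) Filter.atTop (nhds (φ T x)) := by
  have := euler_conv (Fs χ α) (continuous_Fs χ hα) (lip_Fs χ hα) (fun s => φ s x)
    (flow_deriv hφ x) T
  rw [hφ.1 x] at this
  exact this

lemma flow_meas (hα : 0 < α) (hφ : IsFlow χ α φ) (T : ℝ) : Measurable (φ T) :=
  measurable_of_tendsto_metrizable (fun k => (mp_stepk (χ := χ) hα T k).measurable)
    (tendsto_pi_nhds.2 (tendsto_stepk hα hφ T))

lemma flow_vol (hα : 0 < α) (hφ : IsFlow χ α φ) (T : ℝ) {f : XN N → ℝ≥0∞} (hf : Continuous f) :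
    ∫⁻ x, f (φ T x) ≤ ∫⁻ x, f x := by
  calc ∫⁻ x, f (φ T x) = ∫⁻ x, Filter.liminf (fun k => f (stepk χ α T k x)) Filter.atTop := by
        refine lintegral_congr fun x => ?_
        exact (((hf.tendsto _).comp (tendsto_stepk hα hφ T x)).liminf_eq).symm
    _ ≤ Filter.liminf (fun k => ∫⁻ x, f (stepk χ α T k x)) Filter.atTop :=
        lintegral_liminf_le fun k => hf.measurable.comp (mp_stepk hα T k).measurable
    _ = ∫⁻ x, f x := by
        have : ∀ k, ∫⁻ x, f (stepk χ α T k x) = ∫⁻ x, f x :=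
          fun k => (mp_stepk hα T k).lintegral_comp hf.measurable
        simp [this]

lemma hasDerivAt_int (hα : 0 < α) (hφ : IsFlow χ α φ) (x : XN N) (t : ℝ) :
    HasDerivAt (fun s => ∫ y, |wA χ (φ s x).1 y| ^ (α + 2) ∂μΘ)
      (∫ y, (α + 2) * (|wA χ (φ t x).1 y| ^ α * wA χ (φ t x).1 y) * wA χ (Dm (φ t x).2) y ∂μΘ) t := by
  have hc := flow_cont hφ x
  obtain ⟨R, hR⟩ := (isCompact_Icc (a := t - 1) (b := t + 1)).exists_bound_of_continuousOn hc.continuousOn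
  have hK := KN_nonneg (N := N) χ
  have hw : ∀ s y, HasDerivAt (fun s => wA χ (φ s x).1 y) (wA χ (Dm (φ s x).2) y) s := by
    intro s y
    unfold wA
    refine HasDerivAt.fun_sum fun m _ => ?_
    exact (((hφ.2 x s m).1).const_mul _).mul_const _
  have hcont : Continuous (fun z : ℝ => |z| ^ (α + 2)) :=
    continuous_abs.rpow_const fun _ => Or.inr (by linarith)
  refine (hasDerivAt_integral_of_dominated_loc_of_deriv_le (μ := μΘ) (s := Metric.ball t 1)
    (F := fun s y => |wA χ (φ s x).1 y| ^ (α + 2))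
    (F' := fun s y => (α + 2) * (|wA χ (φ s x).1 y| ^ α * wA χ (φ s x).1 y) * wA χ (Dm (φ s x).2) y)
    (bound := fun _ => (α + 2) * ((KN N χ * R) ^ α * (KN N χ * R)) * (KN N χ * (Real.pi * (N + 1) * R)))
    (Metric.ball_mem_nhds t one_pos) ?_ ?_ ?_ ?_ ?_ ?_).2
  · exact Filter.Eventually.of_forall fun s => (hcont.measurable.comp (measurable_wA χ _)).aestronglyMeasurable
  · refine Integrable.of_bound (C := (KN N χ * ‖(φ t x).1‖) ^ (α + 2)) (hcont.measurable.comp (measurable_wA χ _)).aestronglyMeasurable ?_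
    filter_upwards with y
    rw [Real.norm_of_nonneg (by positivity)]
    exact Real.rpow_le_rpow (abs_nonneg _) (wA_bound χ _ y) (by linarith)
  · exact (((((cont_nl hα).measurable.comp (measurable_wA χ _))).const_mul (α + 2)).mul (measurable_wA χ _)).aestronglyMeasurable
  · filter_upwards with y s hs
    have hs' : s ∈ Icc (t - 1) (t + 1) := by
      rw [Real.ball_eq_Ioo] at hs; exact ⟨hs.1.le, hs.2.le⟩
    have hb := hR s hs'
    have h1 : ‖(φ s x).1‖ ≤ R := (norm_fst_le _).trans hb
    have h2 : ‖(φ s x).2‖ ≤ R := (norm_snd_le _).trans hb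
    have hR0 : 0 ≤ R := (norm_nonneg _).trans hb
    have w1 : |wA χ (φ s x).1 y| ≤ KN N χ * R := (wA_bound χ _ y).trans (by gcongr)
    have w2 : |wA χ (Dm (φ s x).2) y| ≤ KN N χ * (Real.pi * (N + 1) * R) :=
      (wA_bound χ _ y).trans (by gcongr; exact (norm_Dm _).trans (by gcongr))
    rw [Real.norm_eq_abs, abs_mul, abs_mul, abs_mul, abs_of_nonneg (by linarith : 0 ≤ α + 2),
      abs_of_nonneg (by positivity : 0 ≤ |wA χ (φ s x).1 y| ^ α)]
    gcongr
  · exact integrable_const _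
  · filter_upwards with y s hs
    have := (hasDerivAt_abs_rpow (wA χ (φ s x).1 y) (by linarith : 1 < α + 2)).comp s (hw s y)
    convert! this using 1
    ring_nf

lemma Ham_flow (hα : 0 < α) (hφ : IsFlow χ α φ) (x : XN N) (t : ℝ) :
    Ham χ α (φ t x) = Ham χ α x := by
  have key : ∀ t, HasDerivAt (fun s => Ham χ α (φ s x)) 0 t := by
    intro t
    have h1 : HasDerivAt (fun s => (1/2) * ∑ n : Fin N, (Real.pi * ((n : ℕ) + 1)) ^ 2 * (((φ s x).1 n) ^ 2 + ((φ s x).2 n) ^ 2))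
      ((1/2) * ∑ n : Fin N, (Real.pi * ((n : ℕ) + 1)) ^ 2 *
        (2 * (φ t x).1 n * (Real.pi * ((n : ℕ) + 1) * (φ t x).2 n) +
         2 * (φ t x).2 n * (-(Real.pi * ((n : ℕ) + 1)) * (φ t x).1 n - Gf χ α (φ t x).1 n))) t := by
      refine HasDerivAt.const_mul _ (HasDerivAt.fun_sum fun n _ => HasDerivAt.const_mul _ ?_)
      have a := ((hφ.2 x t n).1.pow 2).add ((hφ.2 x t n).2.pow 2)
      convert! a using 1
      simp
    have h2 := (hasDerivAt_int hα hφ x t).const_mul (1/(α+2))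
    have h3 := h1.add h2
    convert! h3 using 1
    have e1 : ∫ y, (α + 2) * (|wA χ (φ t x).1 y| ^ α * wA χ (φ t x).1 y) * wA χ (Dm (φ t x).2) y ∂μΘ
      = ∑ n : Fin N, (α + 2) * ((Real.pi * ((n : ℕ) + 1)) ^ 2 * ((φ t x).2 n * Gf χ α (φ t x).1 n)) := by
      have : ∀ y, (α + 2) * (|wA χ (φ t x).1 y| ^ α * wA χ (φ t x).1 y) * wA χ (Dm (φ t x).2) y
        = ∑ n : Fin N, ((α + 2) * χ (((n : ℕ) + 1 : ℝ) ^ 2 / (N : ℝ) ^ 2) * (Real.pi * ((n : ℕ) + 1) * (φ t x).2 n)) * (|wA χ (φ t x).1 y| ^ α * wA χ (φ t x).1 y * eFun ((n:ℕ) + 1) y) := by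
        intro y
        conv_lhs => rw [wA.eq_def χ (Dm (φ t x).2) y]
        rw [Finset.mul_sum]
        refine Finset.sum_congr rfl fun n _ => ?_
        simp only [Dm]; ring
      simp_rw [this]
      rw [integral_finsetSum]
      · refine Finset.sum_congr rfl fun n _ => ?_
        rw [integral_const_mul]
        unfold Gf
        have : Real.pi * ((n:ℕ) + 1 : ℝ) ≠ 0 := by positivity
        field_simp
      · intro n _
        exact (integrable_I χ hα _ _).const_mul _
    rw [e1, Finset.mul_sum, Finset.mul_sum, ← Finset.sum_add_distrib]
    symm
    refine Finset.sum_eq_zero fun n _ => ?_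
    have : α + 2 ≠ 0 := by linarith
    field_simp
    ring
  have hd : Differentiable ℝ (fun s => Ham χ α (φ s x)) := fun t => (key t).differentiableAt
  have := is_const_of_deriv_eq_zero hd (fun t => (key t).deriv) t 0
  simpa [hφ.1 x] using this

/-- (sub)invariance of the Gibbs measure -/
lemma flow_rho (hα : 0 < α) (hφ : IsFlow χ α φ) (T : ℝ) {f : XN N → ℝ} (hf : Continuous f) :
    ∫⁻ x, ENNReal.ofReal (f (φ T x)) ∂(rhoN N χ α) ≤ ∫⁻ x, ENNReal.ofReal (f x) ∂(rhoN N χ α) := by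
  have hH := continuous_Ham (N := N) χ hα
  set w : XN N → ℝ := fun ab => (((2 * Real.pi) ^ N)⁻¹ * (∏ n : Fin N, (Real.pi * ((n : ℕ) + 1)) ^ 2) *
      Real.exp (-(Ham χ α ab))) with hw
  have hwc : Continuous w := by fun_prop
  have hw0 : ∀ x, 0 ≤ w x := fun x => by
    simp only [hw]
    have : 0 ≤ ∏ n : Fin N, (Real.pi * ((n : ℕ) + 1)) ^ 2 := Finset.prod_nonneg fun _ _ => by positivity
    positivity
  have hwi : ∀ x, w (φ T x) = w x := fun x => by simp only [hw, Ham_flow hα hφ]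
  have hm := flow_meas hα hφ T
  unfold rhoN
  rw [lintegral_withDensity_eq_lintegral_mul _ (by exact hwc.measurable.ennreal_ofReal)
      (by exact (hf.measurable.comp hm).ennreal_ofReal),
    lintegral_withDensity_eq_lintegral_mul _ (by exact hwc.measurable.ennreal_ofReal)
      hf.measurable.ennreal_ofReal]
  have e : ∀ x, ENNReal.ofReal (w x) * ENNReal.ofReal (f x) = ENNReal.ofReal (w x * f x) :=
    fun x => (ENNReal.ofReal_mul (hw0 x)).symm
  calc _ = ∫⁻ x, (fun x => ENNReal.ofReal (w x * f x)) (φ T x) := by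
        refine lintegral_congr fun x => ?_
        simp only [Pi.mul_apply]
        rw [← e, hwi]
    _ ≤ ∫⁻ x, ENNReal.ofReal (w x * f x) :=
        flow_vol hα hφ T (ENNReal.continuous_ofReal.comp (hwc.mul hf))
    _ = _ := by
        refine lintegral_congr fun x => ?_
        simp only [Pi.mul_apply]
        rw [← e]

lemma flow_joint (hα : 0 < α) (hφ : IsFlow χ α φ) : Measurable (fun z : ℝ × XN N => φ z.1 z.2) := by
  have := measurable_uncurry_of_continuous_of_measurable (u := fun (s : ℝ) (x : XN N) => φ s x)
    (fun x => flow_cont hφ x) (fun s => flow_meas hα hφ s)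
  exact this
end

end

section

/-- complex coefficient -/
def cf {N : ℕ} (x : XN N) (n : Fin N) : ℂ := (x.1 n : ℂ) + (x.2 n : ℂ) * Complex.I

lemma continuous_cf {N : ℕ} (n : Fin N) : Continuous (fun x : XN N => cf x n) := by
  unfold cf; fun_prop

/-- linear functional -/
def lf {N : ℕ} (β : Fin N → ℂ) (x : XN N) : ℝ := ‖∑ n, β n * cf x n‖

lemma lf_nonneg {N : ℕ} (β : Fin N → ℂ) (x : XN N) : 0 ≤ lf β x := norm_nonneg _

lemma continuous_lf {N : ℕ} (β : Fin N → ℂ) : Continuous (lf β) := by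
  have := continuous_cf (N := N)
  unfold lf; fun_prop

lemma measurable_lf {N : ℕ} {Z : Type*} [MeasurableSpace Z] {β : Z → Fin N → ℂ}
    (hβ : Measurable β) : Measurable (fun z : Z × XN N => lf (β z.1) z.2) := by
  have h1 := fun n => (continuous_cf (N := N) n).measurable
  have h2 : ∀ n, Measurable fun z => β z n := fun n => (measurable_pi_apply n).comp hβ
  unfold lf; fun_prop

def Vf {N : ℕ} {Z : Type*} [MeasurableSpace Z] (c : ℝ) (ν : Measure Z) (β : Z → Fin N → ℂ)
    (x : XN N) : ℝ≥0∞ := ∫⁻ z, ENNReal.ofReal (Real.exp (c * lf (β z) x ^ 2)) ∂ν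

lemma measurable_Vf {N : ℕ} {Z : Type*} [MeasurableSpace Z] (c : ℝ) (ν : Measure Z) [SFinite ν]
    {β : Z → Fin N → ℂ} (hβ : Measurable β) : Measurable (Vf c ν β) := by
  have h := (measurable_lf hβ).comp measurable_swap
  have h2 : Measurable (fun z : XN N × Z => ENNReal.ofReal (Real.exp (c * lf (β z.2) z.1 ^ 2))) := by
    have h' : Measurable (fun z : XN N × Z => lf (β z.2) z.1) := h
    fun_prop
  exact h2.lintegral_prod_right'

lemma lint_cauchy : ∫⁻ s : ℝ, ENNReal.ofReal ((1 + s ^ 2)⁻¹) = ENNReal.ofReal Real.pi := by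
  rw [← ofReal_integral_eq_lintegral_ofReal integrable_inv_one_add_sq
    (Filter.Eventually.of_forall fun s => by positivity), integral_univ_inv_one_add_sq]

lemma Vf_avg {N : ℕ} {χ : ℝ → ℝ} {α : ℝ} {φ : ℝ → XN N → XN N} (hα : 0 < α) (hφ : IsFlow χ α φ)
    {Z : Type*} [MeasurableSpace Z] (c : ℝ) (hc : 0 ≤ c) (ν : Measure Z) [SFinite ν]
    {β : Z → Fin N → ℂ} (hβ : Measurable β)
    (hb : ∀ᵐ z ∂ν, c * ∑ n : Fin N, ‖β z n‖ ^ 2 / (Real.pi * ((n:ℕ) + 1)) ^ 2 ≤ 1/8) :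
    ∫⁻ x, (∫⁻ s : ℝ, ENNReal.ofReal ((1 + s ^ 2)⁻¹) * Vf c ν β (φ s x)) ∂(rhoN N χ α)
      ≤ ENNReal.ofReal Real.pi * (2 * A0 * ν univ) := by
  have hj := flow_joint hα hφ
  have hV := measurable_Vf c ν hβ
  have hm : Measurable (fun z : XN N × ℝ => ENNReal.ofReal ((1 + z.2 ^ 2)⁻¹) * Vf c ν β (φ z.2 z.1)) := by
    have : Measurable (fun z : XN N × ℝ => Vf c ν β (φ z.2 z.1)) := hV.comp (hj.comp measurable_swap)
    fun_prop
  rw [lintegral_lintegral_swap hm.aemeasurable]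
  have key : ∀ s : ℝ, ∫⁻ x, Vf c ν β (φ s x) ∂(rhoN N χ α) ≤ 2 * A0 * ν univ := by
    intro s
    unfold Vf
    have hl : Measurable (fun z : XN N × Z => lf (β z.2) (φ s z.1)) := by
      have := (measurable_lf hβ).comp (measurable_snd.prodMk ((flow_meas hα hφ s).comp measurable_fst) : Measurable (fun z : XN N × Z => (z.2, φ s z.1)))
      exact this
    rw [lintegral_lintegral_swap (Measurable.aemeasurable (by unfold Function.uncurry; fun_prop))]
    calc _ ≤ ∫⁻ z, 2 * A0 ∂ν := by
          refine lintegral_mono_ae ?_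
          filter_upwards [hb] with z hz
          refine (flow_rho hα hφ s (f := fun x => Real.exp (c * lf (β z) x ^ 2)) ?_).trans ?_
          · have := continuous_lf (β z); fun_prop
          · exact rho_exp χ α hα c hc (β z) hz
      _ = _ := by rw [lintegral_const]
  calc _ = ∫⁻ s : ℝ, ENNReal.ofReal ((1 + s ^ 2)⁻¹) * ∫⁻ x, Vf c ν β (φ s x) ∂(rhoN N χ α) := by
        refine lintegral_congr fun s => ?_
        rw [lintegral_const_mul]
        exact hV.comp (flow_meas hα hφ s)
    _ ≤ ∫⁻ s : ℝ, ENNReal.ofReal ((1 + s ^ 2)⁻¹) * (2 * A0 * ν univ) := by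
        gcongr with s; exact key s
    _ = _ := by rw [lintegral_mul_const _ (by fun_prop), lint_cauchy]

/-- Gaussian domination of powers -/
lemma pow_le_exp (q c : ℝ) (hq : 0 ≤ q) (hc : 0 < c) :
    ∃ C : ℝ, 0 < C ∧ ∀ z : ℝ, 0 ≤ z → z ^ q ≤ C * Real.exp (c * z ^ 2) := by
  obtain ⟨m, hm⟩ := exists_nat_ge q
  refine ⟨1 + (m.factorial : ℝ) * (c⁻¹) ^ m, by positivity, fun z hz => ?_⟩
  have h1 : 1 ≤ Real.exp (c * z ^ 2) := Real.one_le_exp (by positivity)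
  rcases le_total z 1 with h | h
  · have : z ^ q ≤ 1 := Real.rpow_le_one hz h hq
    have h2 : (0:ℝ) ≤ (m.factorial : ℝ) * (c⁻¹) ^ m := by positivity
    nlinarith
  · have h2 : z ^ q ≤ (z ^ 2) ^ m := by
      calc z ^ q ≤ z ^ ((2 * m : ℕ) : ℝ) := Real.rpow_le_rpow_of_exponent_le h (by push_cast; linarith)
        _ = (z ^ 2) ^ m := by rw [Real.rpow_natCast, pow_mul]
    have h3 := Real.pow_div_factorial_le_exp (c * z ^ 2) (by positivity) m
    rw [div_le_iff₀ (by positivity), mul_pow] at h3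
    have h4 : (z^2)^m ≤ (m.factorial : ℝ) * (c⁻¹) ^ m * Real.exp (c * z ^ 2) := by
      rw [inv_pow]
      have : (0:ℝ) < c ^ m := by positivity
      field_simp
      rw [mul_comm (z ^ 2) c]
      linarith
    nlinarith [Real.exp_pos (c * z ^ 2)]

lemma pow_le_split (q c : ℝ) (hq : 0 ≤ q) (hc : 0 < c) :
    ∃ C : ℝ, 0 < C ∧ ∀ z : ℝ, 0 ≤ z → ∀ l : ℝ, 0 ≤ l →
      z ^ q ≤ l ^ q + C * Real.exp (- (c * l ^ 2 / 2)) * Real.exp (c * z ^ 2) := by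
  obtain ⟨C, hC, h⟩ := pow_le_exp q (c/2) hq (by positivity)
  refine ⟨C, hC, fun z hz l hl => ?_⟩
  rcases le_total z l with hzl | hzl
  · have := Real.rpow_le_rpow hz hzl hq
    have h2 : 0 ≤ C * Real.exp (- (c * l ^ 2 / 2)) * Real.exp (c * z ^ 2) := by positivity
    linarith
  · have h1 := h z hz
    have h2 : C * Real.exp (c / 2 * z ^ 2) ≤ C * Real.exp (- (c * l ^ 2 / 2)) * Real.exp (c * z ^ 2) := by
      rw [mul_assoc, ← Real.exp_add]
      gcongr
      have : l ^ 2 ≤ z ^ 2 := by gcongr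
      nlinarith
    have h3 : 0 ≤ l ^ q := by positivity
    linarith

lemma moment {N : ℕ} {Z : Type*} [MeasurableSpace Z] (ν : Measure Z) (q c : ℝ)
    {C : ℝ} (hC : 0 < C) (hsp : ∀ z : ℝ, 0 ≤ z → ∀ l : ℝ, 0 ≤ l →
      z ^ q ≤ l ^ q + C * Real.exp (- (c * l ^ 2 / 2)) * Real.exp (c * z ^ 2))
    (β : Z → Fin N → ℂ) (x : XN N) (l : ℝ) (hl : 0 ≤ l) :
    ∫⁻ z, ENNReal.ofReal (lf (β z) x ^ q) ∂ν ≤ ENNReal.ofReal (l ^ q) * ν univ +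
      ENNReal.ofReal (C * Real.exp (- (c * l ^ 2 / 2))) * Vf c ν β x := by
  calc _ ≤ ∫⁻ z, (ENNReal.ofReal (l ^ q) + ENNReal.ofReal (C * Real.exp (- (c * l ^ 2 / 2))) *
          ENNReal.ofReal (Real.exp (c * lf (β z) x ^ 2))) ∂ν := by
        refine lintegral_mono fun z => ?_
        rw [← ENNReal.ofReal_mul (by positivity), ← ENNReal.ofReal_add (by positivity) (by positivity)]
        exact ENNReal.ofReal_le_ofReal (hsp _ (lf_nonneg _ _) l hl)
    _ = _ := by
        rw [lintegral_add_left measurable_const, lintegral_const, lintegral_const_mul' _ _ (by finiteness)]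
        rfl
end

section

lemma exp_period (k : ℤ) (u : ℝ) :
    ∫ s in u..(u+2), Complex.exp ((Real.pi * k * s : ℂ) * Complex.I) = if k = 0 then 2 else 0 := by
  split_ifs with h
  · subst h; simp
  · have hk : (Real.pi * k * Complex.I : ℂ) ≠ 0 := by
      simp [Real.pi_ne_zero, h]
    have := integral_exp_mul_complex (a := u) (b := u + 2) hk
    have e : ∀ s : ℝ, (Real.pi * k * s : ℂ) * Complex.I = (Real.pi * k * Complex.I) * s := fun s => by ring
    simp_rw [e]
    rw [this]
    have e2 : (Real.pi * k * Complex.I : ℂ) * ((u + 2 : ℝ) : ℂ) = (Real.pi * k * Complex.I : ℂ) * u + k * (2 * Real.pi * Complex.I) := by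
      push_cast; ring
    rw [e2, Complex.exp_add, Complex.exp_int_mul_two_pi_mul_I]
    simp

lemma orth {N : ℕ} (b : Fin N → ℂ) (u : ℝ) :
    ∫ s in u..(u+2), ‖∑ n : Fin N, b n * Complex.exp ((Real.pi * ((n:ℕ) + 1) * s : ℂ) * Complex.I)‖ ^ 2
      = 2 * ∑ n, ‖b n‖ ^ 2 := by
  have e : ∀ s : ℝ, ((‖∑ n : Fin N, b n * Complex.exp ((Real.pi * ((n:ℕ) + 1) * s : ℂ) * Complex.I)‖ ^ 2 : ℝ) : ℂ)
      = ∑ n : Fin N, ∑ m : Fin N, (b n * (starRingEnd ℂ) (b m)) * Complex.exp ((Real.pi * (((n:ℕ):ℤ) - ((m:ℕ):ℤ) : ℤ) * s : ℂ) * Complex.I) := by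
    intro s
    rw [Complex.ofReal_pow, ← Complex.mul_conj', map_sum, Finset.sum_mul_sum]
    refine Finset.sum_congr rfl fun n _ => Finset.sum_congr rfl fun m _ => ?_
    rw [map_mul, ← Complex.exp_conj]
    rw [mul_mul_mul_comm, ← Complex.exp_add]
    congr 2
    simp only [map_mul, map_add, Complex.conj_ofReal, Complex.conj_I, map_natCast, map_one]
    push_cast
    ring
  apply Complex.ofReal_injective
  rw [← intervalIntegral.integral_ofReal]
  simp_rw [e]
  rw [intervalIntegral.integral_finsetSum (fun n _ => Continuous.intervalIntegrable (by fun_prop) _ _)]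
  have : ∀ n : Fin N, ∫ s in u..(u+2), ∑ m : Fin N, (b n * (starRingEnd ℂ) (b m)) * Complex.exp ((Real.pi * (((n:ℕ):ℤ) - ((m:ℕ):ℤ) : ℤ) * s : ℂ) * Complex.I) = 2 * ((‖b n‖^2 : ℝ) : ℂ) := by
    intro n
    rw [intervalIntegral.integral_finsetSum (fun n _ => Continuous.intervalIntegrable (by fun_prop) _ _)]
    rw [Finset.sum_eq_single n]
    · rw [intervalIntegral.integral_const_mul, exp_period]
      simp [Complex.mul_conj']
      ring
    · intro m _ hm
      rw [intervalIntegral.integral_const_mul, exp_period, if_neg, mul_zero]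
      intro h
      apply hm
      ext
      omega
    · simp
  simp_rw [this]
  push_cast
  rw [Finset.mul_sum]
end

section

def Ee (n : ℕ) (s : ℝ) : ℂ := Complex.exp ((Real.pi * ((n:ℕ) + 1) * s : ℂ) * Complex.I)

lemma norm_Ee (n : ℕ) (s : ℝ) : ‖Ee n s‖ = 1 := by
  have : (Real.pi * ((n:ℕ) + 1) * s : ℂ) = ((Real.pi * (n+1) * s : ℝ) : ℂ) := by push_cast; ring
  rw [Ee, this, Complex.norm_exp_ofReal_mul_I]

lemma continuous_Ee (n : ℕ) : Continuous (Ee n) := by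
  unfold Ee; fun_prop

lemma hasDerivAt_Ee (n : ℕ) (s : ℝ) :
    HasDerivAt (Ee n) (Ee n s * (Real.pi * (n + 1) * Complex.I)) s := by
  unfold Ee
  have h1 : HasDerivAt (fun s : ℝ => (Real.pi * ((n:ℕ) + 1) * s : ℂ) * Complex.I) (Real.pi * (n + 1) * Complex.I) s := by
    have := ((Complex.ofRealCLM.hasDerivAt (x := s)).const_mul (Real.pi * ((n:ℕ) + 1) : ℂ)).mul_const Complex.I
    simpa using this
  exact h1.cexp

section
variable {N : ℕ} {χ : ℝ → ℝ} {α : ℝ} {φ : ℝ → XN N → XN N}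

lemma hasDerivAt_prof (hφ : IsFlow χ α φ) (x : XN N) (n : Fin N) (s : ℝ) :
    HasDerivAt (fun s => Ee n s * cf (φ s x) n) (Ee n s * (-Complex.I * (Gf χ α (φ s x).1 n : ℂ))) s := by
  have h1 := (hφ.2 x s n).1.ofReal_comp
  have h2 := (hφ.2 x s n).2.ofReal_comp
  have h3 : HasDerivAt (fun s => cf (φ s x) n) _ s := h1.add (h2.mul_const Complex.I)
  have h4 := (hasDerivAt_Ee n s).mul h3
  convert! h4 using 1
  unfold cf
  push_cast
  linear_combination Ee n s * Real.pi * (n + 1) * ((φ s x).2 n : ℂ) * (-Complex.I_mul_I)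

/-- increment of the interaction-picture profile -/
def Dd (φ : ℝ → XN N → XN N) (x : XN N) (s0 t : ℝ) (n : Fin N) : ℂ :=
  Ee n t * cf (φ t x) n - Ee n s0 * cf (φ s0 x) n

def Kk (χ : ℝ → ℝ) (A : Fin N → ℂ) (s : ℝ) (y : E3) : ℝ :=
  ∑ n : Fin N, ((starRingEnd ℂ (A n)) * (Ee n s * (-Complex.I))).re *
    (χ (((n : ℕ) + 1 : ℝ) ^ 2 / (N : ℝ) ^ 2) * eFun ((n:ℕ) + 1) y)

lemma duh_identity (hα : 0 < α) (hφ : IsFlow χ α φ) (x : XN N) (s0 t : ℝ) :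
    ∑ n : Fin N, (Real.pi * ((n:ℕ) + 1)) ^ 2 * ‖Dd φ x s0 t n‖ ^ 2 =
      ∫ s in s0..t, ∫ y, |wA χ (φ s x).1 y| ^ α * wA χ (φ s x).1 y *
        Kk χ (fun n => (Real.pi * ((n:ℕ) + 1) : ℝ) * Dd φ x s0 t n) s y ∂μΘ := by
  set A : Fin N → ℂ := fun n => (Real.pi * ((n:ℕ) + 1) : ℝ) * Dd φ x s0 t n with hA
  have hQ' : ∀ s, ∫ y, |wA χ (φ s x).1 y| ^ α * wA χ (φ s x).1 y * Kk χ A s y ∂μΘ =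
      ∑ n : Fin N, ((starRingEnd ℂ (A n)) * (Ee n s * (-Complex.I))).re * ((Real.pi * ((n:ℕ) + 1)) * Gf χ α (φ s x).1 n) := by
    intro s
    have : ∀ y, |wA χ (φ s x).1 y| ^ α * wA χ (φ s x).1 y * Kk χ A s y =
      ∑ n : Fin N, (((starRingEnd ℂ (A n)) * (Ee n s * (-Complex.I))).re * χ (((n : ℕ) + 1 : ℝ) ^ 2 / (N : ℝ) ^ 2)) *
        (|wA χ (φ s x).1 y| ^ α * wA χ (φ s x).1 y * eFun ((n:ℕ) + 1) y) := by
      intro y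
      unfold Kk
      rw [Finset.mul_sum]
      refine Finset.sum_congr rfl fun n _ => ?_
      ring
    simp_rw [this]
    rw [integral_finsetSum]
    · refine Finset.sum_congr rfl fun n _ => ?_
      rw [integral_const_mul]
      unfold Gf
      have : Real.pi * ((n:ℕ) + 1 : ℝ) ≠ 0 := by positivity
      field_simp
    · intro n _
      exact (integrable_I χ hα _ _).const_mul _
  simp_rw [hQ']
  have hder : ∀ s, HasDerivAt (fun s => ∑ n : Fin N, ((starRingEnd ℂ (A n)) * ((Real.pi * ((n:ℕ) + 1) : ℝ) * (Ee n s * cf (φ s x) n))).re)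
      (∑ n : Fin N, ((starRingEnd ℂ (A n)) * (Ee n s * (-Complex.I))).re * ((Real.pi * ((n:ℕ) + 1)) * Gf χ α (φ s x).1 n)) s := by
    intro s
    refine HasDerivAt.fun_sum fun n _ => ?_
    have h := ((hasDerivAt_prof hφ x n s).const_mul ((Real.pi * ((n:ℕ) + 1) : ℝ) : ℂ)).const_mul (starRingEnd ℂ (A n))
    have h2 := Complex.reCLM.hasFDerivAt.comp_hasDerivAt s h
    convert! h2 using 1
    rw [Complex.reCLM_apply]
    rw [show (starRingEnd ℂ (A n)) * (((Real.pi * ((n:ℕ) + 1) : ℝ) : ℂ) * (Ee n s * (-Complex.I * (Gf χ α (φ s x).1 n : ℂ)))) = ((starRingEnd ℂ (A n)) * (Ee n s * (-Complex.I))) * ((Real.pi * ((n:ℕ) + 1) * Gf χ α (φ s x).1 n : ℝ) : ℂ) by push_cast; ring]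
    rw [Complex.re_mul_ofReal]
  rw [intervalIntegral.integral_eq_sub_of_hasDerivAt (fun s _ => hder s)]
  · rw [← Finset.sum_sub_distrib]
    refine Finset.sum_congr rfl fun n _ => ?_
    rw [← Complex.sub_re, ← mul_sub, ← mul_sub]
    change _ = ((starRingEnd ℂ (A n)) * A n).re
    rw [Complex.conj_mul', ← Complex.ofReal_pow, Complex.ofReal_re]
    simp only [hA]
    rw [norm_mul, Complex.norm_real, Real.norm_of_nonneg (by positivity), mul_pow (_ * _)]
  · apply Continuous.intervalIntegrable
    have h1 : Continuous (fun s => Gf χ α (φ s x).1) := (continuous_Gf χ hα).comp (continuous_fst.comp (flow_cont hφ x))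
    have h2 := fun n : ℕ => continuous_Ee n
    have h3 : ∀ n, Continuous (fun s => Gf χ α (φ s x).1 n) := fun n => (continuous_apply n).comp h1
    refine continuous_finsetSum _ fun n _ => Continuous.mul ?_ (continuous_const.mul (h3 n))
    exact Complex.continuous_re.comp (continuous_const.mul ((h2 n).mul continuous_const))

lemma meas_Kk (A : Fin N → ℂ) : Measurable (fun z : ℝ × E3 => Kk χ A z.1 z.2) := by
  unfold Kk
  have h1 := fun n : ℕ => (continuous_Ee n).measurable
  have h2 := measurable_eFun
  refine Finset.measurable_fun_sum _ fun n _ => ?_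
  refine Measurable.mul ?_ ?_
  · refine Complex.measurable_re.comp ?_
    have := (h1 n).comp (measurable_fst : Measurable (Prod.fst : ℝ × E3 → ℝ))
    exact ((this.mul_const _).const_mul _)
  · exact ((h2 _).comp measurable_snd).const_mul _

lemma Kk_sq {X : ℝ} (hX : ∀ z, |χ z| ≤ X) (A : Fin N → ℂ) (s0 t : ℝ) (ht : t ≤ s0 + 2) (y : E3) :
    ∫⁻ s in Ioc s0 t, ENNReal.ofReal (Kk χ A s y ^ 2) ≤
      ENNReal.ofReal (2 * X ^ 2 * (∑ n, ‖A n‖ ^ 2) * (‖y‖⁻¹) ^ 2) := by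
  have hX0 : 0 ≤ X := (abs_nonneg _).trans (hX 0)
  set b : Fin N → ℂ := fun n => (starRingEnd ℂ (A n)) * (-Complex.I) * ((χ (((n : ℕ) + 1 : ℝ) ^ 2 / (N : ℝ) ^ 2) * eFun ((n:ℕ) + 1) y : ℝ) : ℂ) with hb
  have hK : ∀ s, Kk χ A s y ^ 2 ≤ ‖∑ n : Fin N, b n * Complex.exp ((Real.pi * ((n:ℕ) + 1) * s : ℂ) * Complex.I)‖ ^ 2 := by
    intro s
    have : Kk χ A s y = (∑ n : Fin N, b n * Complex.exp ((Real.pi * ((n:ℕ) + 1) * s : ℂ) * Complex.I)).re := by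
      rw [Complex.re_sum]
      unfold Kk
      refine Finset.sum_congr rfl fun n _ => ?_
      rw [← Complex.re_mul_ofReal]
      congr 1
      simp only [hb, Ee]
      ring
    rw [this, ← sq_abs]
    gcongr
    exact Complex.abs_re_le_norm _
  have hc : Continuous (fun s : ℝ => ‖∑ n : Fin N, b n * Complex.exp ((Real.pi * ((n:ℕ) + 1) * s : ℂ) * Complex.I)‖ ^ 2) := by fun_prop
  calc _ ≤ ∫⁻ s in Ioc s0 (s0+2), ENNReal.ofReal (‖∑ n : Fin N, b n * Complex.exp ((Real.pi * ((n:ℕ) + 1) * s : ℂ) * Complex.I)‖ ^ 2) :=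
        lintegral_mono' (Measure.restrict_mono (Ioc_subset_Ioc_right ht) le_rfl) fun s => ENNReal.ofReal_le_ofReal (hK s)
    _ = ENNReal.ofReal (2 * ∑ n, ‖b n‖ ^ 2) := by
        rw [← ofReal_integral_eq_lintegral_ofReal, ← intervalIntegral.integral_of_le (by linarith), orth]
        · exact (hc.intervalIntegrable s0 (s0+2)).1
        · exact Filter.Eventually.of_forall fun s => by positivity
    _ ≤ _ := by
        apply ENNReal.ofReal_le_ofReal
        rw [mul_assoc, mul_assoc]
        gcongr
        rw [Finset.sum_mul, Finset.mul_sum]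
        refine Finset.sum_le_sum fun n _ => ?_
        simp only [hb]
        rw [norm_mul, norm_mul, norm_neg, Complex.norm_I, mul_one, Complex.norm_real, RCLike.norm_conj, norm_mul, mul_pow, mul_pow]
        have h1 : ‖χ (((n : ℕ) + 1 : ℝ) ^ 2 / (N : ℝ) ^ 2)‖ ^ 2 ≤ X ^ 2 := by gcongr; exact hX _
        have h2 : ‖eFun ((n:ℕ) + 1) y‖ ^ 2 ≤ (‖y‖⁻¹) ^ 2 := by gcongr; exact abs_eFun_le' _ _
        calc _ ≤ ‖A n‖ ^ 2 * (X ^ 2 * (‖y‖⁻¹) ^ 2) := by gcongr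
          _ = _ := by ring

lemma wA_zero (a : Fin N → ℝ) : wA χ a 0 = 0 := by
  unfold wA; simp [eFun_zero]

lemma split_lint {f g : ℝ × E3 → ℝ≥0∞} (hf : Measurable f) (hg : Measurable g)
    (ρ : Measure ℝ) [SFinite ρ] {c : ℝ≥0∞} (hc : c ≠ ⊤) :
    ∫⁻ s, ∫⁻ y, (c * f (s, y) + g (s, y)) ∂μΘ ∂ρ =
      c * ∫⁻ s, ∫⁻ y, f (s, y) ∂μΘ ∂ρ + ∫⁻ y, ∫⁻ s, g (s, y) ∂ρ ∂μΘ := by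
  rw [← lintegral_const_mul' _ _ hc, ← lintegral_lintegral_swap (f := fun s y => g (s, y)) (by exact hg.aemeasurable),
    ← lintegral_add_right _ hg.lintegral_prod_right']
  refine lintegral_congr fun s => ?_
  rw [lintegral_add_left (f := fun y => c * f (s, y)) ((hf.comp measurable_prodMk_left).const_mul c), lintegral_const_mul' _ _ hc]

set_option maxHeartbeats 1000000 in
/-- The smoothing estimate. -/
lemma duhamel (hα : 0 < α) (hα3 : α < 3) {X : ℝ} (hX : ∀ z, |χ z| ≤ X) (hX1 : 1 ≤ X) :
    ∃ K : ℝ, 0 < K ∧ ∀ (N : ℕ) (φ : ℝ → XN N → XN N), IsFlow χ α φ → ∀ (x : XN N) (s0 t : ℝ),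
      s0 ≤ t → t ≤ s0 + 2 →
      ENNReal.ofReal (∑ n : Fin N, (Real.pi * ((n:ℕ) + 1)) ^ 2 * ‖Dd φ x s0 t n‖ ^ 2) ≤
      ENNReal.ofReal K * ∫⁻ s in Ioc s0 t, ∫⁻ y, ENNReal.ofReal (‖y‖ ^ ((α + 3)/2 - 2) * (|wA χ (φ s x).1 y| ^ (α + 1)) ^ 2) ∂μΘ := by
  set a : ℝ := (α + 3)/2 with ha
  have hM := lintegral_norm_rpow (a := a) (by linarith)
  set M : ℝ := (∫⁻ x, ENNReal.ofReal (‖x‖ ^ (-a)) ∂μΘ).toReal + 1 with hMdef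
  have hM1 : 1 ≤ M := by rw [hMdef]; linarith [ENNReal.toReal_nonneg (a := ∫⁻ x, ENNReal.ofReal (‖x‖ ^ (-a)) ∂μΘ)]
  have hM2 : ∫⁻ x, ENNReal.ofReal (‖x‖ ^ (-a)) ∂μΘ ≤ ENNReal.ofReal M := by
    rw [← ENNReal.ofReal_toReal hM.ne]
    exact ENNReal.ofReal_le_ofReal (by rw [hMdef]; linarith)
  set δ : ℝ := (2 * X ^ 2 * M)⁻¹ with hδ
  have hδ0 : 0 < δ := by positivity
  refine ⟨δ⁻¹, by positivity, ?_⟩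
  intro N φ hφ x s0 t hst ht
  set A : Fin N → ℂ := fun n => (Real.pi * ((n:ℕ) + 1) : ℝ) * Dd φ x s0 t n with hA
  set S : ℝ := ∑ n : Fin N, (Real.pi * ((n:ℕ) + 1)) ^ 2 * ‖Dd φ x s0 t n‖ ^ 2 with hS
  have hS0 : 0 ≤ S := Finset.sum_nonneg fun _ _ => by positivity
  have hSA : ∑ n, ‖A n‖ ^ 2 = S := by
    refine Finset.sum_congr rfl fun n _ => ?_
    simp only [hA]
    rw [norm_mul, mul_pow, Complex.norm_real, Real.norm_of_nonneg (by positivity)]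
  set J := ∫⁻ s in Ioc s0 t, ∫⁻ y, ENNReal.ofReal (‖y‖ ^ (a - 2) * (|wA χ (φ s x).1 y| ^ (α + 1)) ^ 2) ∂μΘ with hJ
  have hwm : Measurable (fun z : ℝ × E3 => wA χ (φ z.1 x).1 z.2) := by
    have := (measurable_wA_uncurry (N := N) χ).comp
      (((measurable_fst.comp (flow_cont hφ x).measurable).comp measurable_fst).prodMk measurable_snd : Measurable (fun z : ℝ × E3 => ((φ z.1 x).1, z.2)))
    exact this
  have hKm := meas_Kk (χ := χ) A
  have step1 : ENNReal.ofReal S ≤ ∫⁻ s in Ioc s0 t, ∫⁻ y, ENNReal.ofReal (|wA χ (φ s x).1 y| ^ (α+1) * |Kk χ A s y|) ∂μΘ := by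
    have h := duh_identity hα hφ x s0 t
    rw [← hS, intervalIntegral.integral_of_le hst] at h
    calc ENNReal.ofReal S = ‖S‖ₑ := (Real.enorm_of_nonneg hS0).symm
      _ ≤ ∫⁻ s in Ioc s0 t, ‖∫ y, |wA χ (φ s x).1 y| ^ α * wA χ (φ s x).1 y * Kk χ A s y ∂μΘ‖ₑ := by
        rw [h]; exact enorm_integral_le_lintegral_enorm _
      _ ≤ _ := by
        refine lintegral_mono fun s => (enorm_integral_le_lintegral_enorm _).trans (lintegral_mono fun y => ?_)
        rw [Real.enorm_eq_ofReal_abs]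
        apply ENNReal.ofReal_le_ofReal
        rw [abs_mul, abs_mul, abs_of_nonneg (by positivity : 0 ≤ |wA χ (φ s x).1 y| ^ α), Real.rpow_add_one' (abs_nonneg _) (by linarith)]
  have young : ∀ s y, ENNReal.ofReal (|wA χ (φ s x).1 y| ^ (α+1) * |Kk χ A s y|) ≤
      ENNReal.ofReal ((2*δ)⁻¹) * ENNReal.ofReal (‖y‖ ^ (a - 2) * (|wA χ (φ s x).1 y| ^ (α + 1)) ^ 2) +
      ENNReal.ofReal (δ/2 * ‖y‖ ^ (2 - a)) * ENNReal.ofReal (Kk χ A s y ^ 2) := by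
    intro s y
    rw [← ENNReal.ofReal_mul (by positivity), ← ENNReal.ofReal_mul (by positivity), ← ENNReal.ofReal_add (by positivity) (by positivity)]
    apply ENNReal.ofReal_le_ofReal
    by_cases hy : y = 0
    · subst hy
      rw [wA_zero, abs_zero, Real.zero_rpow (by linarith)]
      simp only [zero_mul]
      positivity
    have hy' : 0 < ‖y‖ := norm_pos_iff.2 hy
    set r := ‖y‖ ^ (a - 2) with hr
    have hr0 : 0 < r := by positivity
    have hr2 : ‖y‖ ^ (2 - a) = r⁻¹ := by rw [hr, ← Real.rpow_neg hy'.le]; ring_nf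
    rw [hr2, ← sq_abs (Kk χ A s y)]
    set u := |wA χ (φ s x).1 y| ^ (α+1)
    set v := |Kk χ A s y|
    have e : (2*δ)⁻¹ * (r * u^2) + δ/2 * r⁻¹ * v^2 - u * v = (2 * δ * r)⁻¹ * (r * u - δ * v)^2 := by
      field_simp
      ring
    have : 0 ≤ (2 * δ * r)⁻¹ * (r * u - δ * v)^2 := by positivity
    linarith
  have step2 : ENNReal.ofReal S ≤ ENNReal.ofReal ((2*δ)⁻¹) * J + ENNReal.ofReal (S/2) := by
    refine step1.trans ((lintegral_mono fun s => lintegral_mono fun y => young s y).trans ?_)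
    have m1 : Measurable (fun z : ℝ × E3 => ENNReal.ofReal (‖z.2‖ ^ (a - 2) * (|wA χ (φ z.1 x).1 z.2| ^ (α + 1)) ^ 2)) := by
      fun_prop
    have m2 : Measurable (fun z : ℝ × E3 => ENNReal.ofReal (δ/2 * ‖z.2‖ ^ (2 - a)) * ENNReal.ofReal (Kk χ A z.1 z.2 ^ 2)) := by
      fun_prop
    rw [split_lint m1 m2 (volume.restrict (Ioc s0 t)) (by finiteness)]
    refine add_le_add le_rfl ?_
    calc _ = ∫⁻ y, ENNReal.ofReal (δ/2 * ‖y‖ ^ (2 - a)) * (∫⁻ s in Ioc s0 t, ENNReal.ofReal (Kk χ A s y ^ 2)) ∂μΘ := by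
          refine lintegral_congr fun y => ?_
          exact lintegral_const_mul' (ENNReal.ofReal (δ/2 * ‖y‖ ^ (2 - a))) (fun s => ENNReal.ofReal (Kk χ A s y ^ 2)) ENNReal.ofReal_ne_top
      _ ≤ ∫⁻ y, ENNReal.ofReal (δ * X ^ 2 * S) * ENNReal.ofReal (‖y‖ ^ (-a)) ∂μΘ := by
          have hne : ∀ᵐ y ∂μΘ, y ≠ 0 := by
            unfold μΘ
            exact ae_restrict_of_ae (by simp [ae_iff])
          refine lintegral_mono_ae ?_
          filter_upwards [hne] with y hy
          refine (mul_le_mul_right (Kk_sq hX A s0 t ht y) _).trans ?_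
          rw [← ENNReal.ofReal_mul (by positivity), ← ENNReal.ofReal_mul (by positivity), hSA]
          apply ENNReal.ofReal_le_ofReal
          have hy' : 0 < ‖y‖ := norm_pos_iff.2 hy
          have : ‖y‖ ^ (-a) = ‖y‖ ^ (2 - a) * (‖y‖⁻¹)^2 := by
            rw [sub_eq_add_neg, Real.rpow_add hy', Real.rpow_two]
            field_simp
          rw [this]
          apply le_of_eq
          ring
      _ ≤ ENNReal.ofReal (δ * X ^ 2 * S) * ENNReal.ofReal M := by
          rw [lintegral_const_mul' _ _ (by finiteness)]
          gcongr
      _ = ENNReal.ofReal (S/2) := by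
          rw [← ENNReal.ofReal_mul (by positivity)]
          congr 1
          rw [hδ]
          field_simp
  by_cases hJt : J = ⊤
  · rw [hJt, ENNReal.mul_top (by simpa using hδ0)]; exact le_top
  · rw [← ENNReal.ofReal_toReal hJt] at step2 ⊢
    have hj0 := ENNReal.toReal_nonneg (a := J)
    rw [← ENNReal.ofReal_mul (by positivity), ← ENNReal.ofReal_add (by positivity) (by positivity), ENNReal.ofReal_le_ofReal_iff (by positivity)] at step2
    rw [← ENNReal.ofReal_mul (by positivity)]
    apply ENNReal.ofReal_le_ofReal
    have : (2*δ)⁻¹ * J.toReal = δ⁻¹ * J.toReal / 2 := by field_simp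
    linarith
end
end

section

/-- weighted measures on the ball -/
def wt (b : ℝ) : Measure E3 := μΘ.withDensity (fun y => ENNReal.ofReal (‖y‖ ^ (-b)))

instance (b : ℝ) : SFinite (wt b) := by unfold wt; infer_instance

lemma wt_univ {b : ℝ} (hb : b < 3) : wt b univ < ⊤ := by
  rw [wt, withDensity_apply _ MeasurableSet.univ, Measure.restrict_univ]
  exact lintegral_norm_rpow hb

lemma lint_wt (b : ℝ) {f : E3 → ℝ≥0∞} (hf : Measurable f) :
    ∫⁻ y, f y ∂(wt b) = ∫⁻ y, ENNReal.ofReal (‖y‖ ^ (-b)) * f y ∂μΘ := by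
  rw [wt, lintegral_withDensity_eq_lintegral_mul _ (by fun_prop) hf]
  rfl

lemma ae_ne_zero : ∀ᵐ y ∂μΘ, y ≠ 0 := by
  unfold μΘ
  exact ae_restrict_of_ae (by simp [ae_iff])

lemma ae_wt (b : ℝ) : ∀ᵐ y ∂(wt b), ‖y‖ ≤ 1 :=
  (withDensity_absolutelyContinuous _ _).ae_le ae_μΘ

section
variable {N : ℕ}

lemma measurable_lf' {Z : Type*} [MeasurableSpace Z] {β : Z → Fin N → ℂ}
    (hβ : Measurable β) (u : XN N) : Measurable (fun z : Z => lf (β z) u) := by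
  have h2 : ∀ n, Measurable fun z => β z n := fun n => (measurable_pi_apply n).comp hβ
  unfold lf; fun_prop

def be1 (z : ℝ × E3) (n : Fin N) : ℂ :=
  ((‖z.2‖ ^ (1/2 : ℝ) * eFun ((n:ℕ) + 1) z.2 : ℝ) : ℂ) * Ee n (-z.1)

def be2 (n : Fin N) (m : Fin N) : ℂ := if m = n then ((Real.pi * ((n:ℕ) + 1) : ℝ) : ℂ) else 0

def be3 (χ : ℝ → ℝ) (y : E3) (n : Fin N) : ℂ :=
  ((‖y‖ ^ (1/2 : ℝ) * (χ (((n : ℕ) + 1 : ℝ) ^ 2 / (N : ℝ) ^ 2) * eFun ((n:ℕ) + 1) y) : ℝ) : ℂ)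

lemma meas_be1 : Measurable (be1 (N := N)) := by
  refine measurable_pi_lambda _ fun n => ?_
  unfold be1
  have h1 := measurable_eFun
  have h2 := (continuous_Ee n).measurable
  fun_prop

lemma meas_be3 (χ : ℝ → ℝ) : Measurable (be3 (N := N) χ) := by
  refine measurable_pi_lambda _ fun n => ?_
  unfold be3
  have h1 := measurable_eFun
  fun_prop

lemma sqrt_norm_sq (y : E3) : (‖y‖ ^ (1/2 : ℝ)) ^ 2 = ‖y‖ := by
  rw [← Real.sqrt_eq_rpow, Real.sq_sqrt (norm_nonneg _)]

lemma be1_sum (z : ℝ × E3) (hz : ‖z.2‖ ≤ 1) :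
    ∑ n : Fin N, ‖be1 z n‖ ^ 2 / (Real.pi * ((n:ℕ) + 1)) ^ 2 ≤ 1 := by
  refine le_trans (le_of_eq ?_) (eFun_sq_sum N z.2 hz)
  rw [Finset.mul_sum]
  refine Finset.sum_congr rfl fun n _ => ?_
  unfold be1
  rw [norm_mul, norm_Ee, mul_one, Complex.norm_real, Real.norm_eq_abs, sq_abs, mul_pow, sqrt_norm_sq, mul_div_assoc]

lemma be2_sum (m : Fin N) :
    ∑ n : Fin N, ‖be2 m n‖ ^ 2 / (Real.pi * ((n:ℕ) + 1)) ^ 2 ≤ 1 := by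
  rw [Finset.sum_eq_single m]
  · unfold be2
    rw [if_pos rfl, Complex.norm_real, Real.norm_eq_abs, sq_abs, div_self (by positivity)]
  · intro b _ hb
    simp [be2, hb]
  · simp

lemma be3_sum {χ : ℝ → ℝ} {X : ℝ} (hX : ∀ z, |χ z| ≤ X) (y : E3) (hz : ‖y‖ ≤ 1) :
    ∑ n : Fin N, ‖be3 χ y n‖ ^ 2 / (Real.pi * ((n:ℕ) + 1)) ^ 2 ≤ X ^ 2 := by
  have h := eFun_sq_sum N y hz
  refine le_trans ?_ (mul_le_mul_of_nonneg_left h (sq_nonneg X) |>.trans (by rw [mul_one]))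
  rw [Finset.mul_sum, Finset.mul_sum]
  refine Finset.sum_le_sum fun n _ => ?_
  unfold be3
  rw [Complex.norm_real, Real.norm_eq_abs, sq_abs, mul_pow, mul_pow, sqrt_norm_sq]
  have h1 : χ (((n : ℕ) + 1 : ℝ) ^ 2 / (N : ℝ) ^ 2) ^ 2 ≤ X ^ 2 := by
    rw [← sq_abs]; gcongr; exact hX _
  calc _ = χ (((n : ℕ) + 1 : ℝ) ^ 2 / (N : ℝ) ^ 2) ^ 2 * (‖y‖ * (eFun ((n:ℕ)+1) y ^ 2 / (Real.pi * ((n:ℕ) + 1)) ^ 2)) := by ring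
    _ ≤ _ := by gcongr

lemma w_lf {χ : ℝ → ℝ} {α : ℝ} (hα : 0 < α) (u : XN N) (y : E3) (hy : y ≠ 0) :
    ‖y‖ ^ ((α + 3)/2 - 2) * (|wA χ u.1 y| ^ (α + 1)) ^ 2 ≤
      ‖y‖ ^ (-((α + 3)/2)) * lf (be3 χ y) u ^ (2 * (α + 1)) := by
  have hy' : 0 < ‖y‖ := norm_pos_iff.2 hy
  have h1 : ‖y‖ ^ (1/2 : ℝ) * |wA χ u.1 y| ≤ lf (be3 χ y) u := by
    have : ‖y‖ ^ (1/2 : ℝ) * wA χ u.1 y = (∑ n, be3 χ y n * cf u n).re := by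
      rw [Complex.re_sum, wA, Finset.mul_sum]
      refine Finset.sum_congr rfl fun n _ => ?_
      rw [be3, Complex.re_ofReal_mul, cf]
      simp
      ring
    calc _ = |‖y‖ ^ (1/2 : ℝ) * wA χ u.1 y| := by rw [abs_mul, abs_of_nonneg (by positivity : 0 ≤ ‖y‖ ^ (1/2 : ℝ))]
      _ ≤ _ := by rw [this]; exact Complex.abs_re_le_norm _
  have h2 : (‖y‖ ^ (1/2 : ℝ) * |wA χ u.1 y|) ^ (2 * (α + 1)) ≤ lf (be3 χ y) u ^ (2 * (α + 1)) :=
    Real.rpow_le_rpow (by positivity) h1 (by linarith)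
  refine le_trans (le_of_eq ?_) (mul_le_mul_of_nonneg_left h2 (by positivity))
  rw [Real.mul_rpow (by positivity) (by positivity), ← Real.rpow_mul hy'.le, ← mul_assoc, ← Real.rpow_add hy',
    ← Real.rpow_natCast (|wA χ u.1 y| ^ (α + 1)) 2, ← Real.rpow_mul (abs_nonneg _)]
  congr 2
  · ring
  · push_cast; ring

lemma lint_w_lf {χ : ℝ → ℝ} {α : ℝ} (hα : 0 < α) (u : XN N) :
    ∫⁻ y, ENNReal.ofReal (‖y‖ ^ ((α + 3)/2 - 2) * (|wA χ u.1 y| ^ (α + 1)) ^ 2) ∂μΘ ≤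
      ∫⁻ y, ENNReal.ofReal (lf (be3 χ y) u ^ (2 * (α + 1))) ∂(wt ((α + 3)/2)) := by
  have hm : Measurable (fun y => lf (be3 χ y) u) :=
    measurable_lf' (meas_be3 χ) u
  rw [lint_wt _ (by fun_prop)]
  refine lintegral_mono_ae ?_
  filter_upwards [ae_ne_zero] with y hy
  rw [← ENNReal.ofReal_mul (by positivity)]
  exact ENNReal.ofReal_le_ofReal (w_lf hα u y hy)

/-- discrete measure for the Sobolev norm -/
def nu2 (N : ℕ) (s : ℝ) : Measure (Fin N) :=
  Measure.count.withDensity (fun n => ENNReal.ofReal ((Real.pi * ((n:ℕ) + 1)) ^ (2 * s - 2)))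

instance (s : ℝ) : SFinite (nu2 N s) := by unfold nu2; infer_instance

lemma lint_nu2 (s : ℝ) (f : Fin N → ℝ≥0∞) :
    ∫⁻ n, f n ∂(nu2 N s) = ∑ n : Fin N, ENNReal.ofReal ((Real.pi * ((n:ℕ) + 1)) ^ (2 * s - 2)) * f n := by
  rw [nu2, lintegral_withDensity_eq_lintegral_mul _ (measurable_of_finite _) (measurable_of_finite _), lintegral_count, tsum_fintype]
  rfl

def M2 (s : ℝ) : ℝ≥0∞ := ∑' n : ℕ, ENNReal.ofReal ((Real.pi * ((n:ℕ) + 1)) ^ (2 * s - 2))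

lemma M2_lt_top {s : ℝ} (hs : s < 1/2) : M2 s < ⊤ := by
  unfold M2
  have h1 : Summable (fun n : ℕ => (Real.pi * ((n:ℕ) + 1 : ℝ)) ^ (2 * s - 2)) := by
    have h2 : Summable (fun n : ℕ => ((n:ℝ)) ^ (2 * s - 2)) := Real.summable_nat_rpow.2 (by linarith)
    have h3 := ((_root_.summable_nat_add_iff 1).2 h2).mul_left (Real.pi ^ (2 * s - 2))
    refine h3.congr fun n => ?_
    rw [Real.mul_rpow (by positivity) (by positivity)]
    push_cast
    rfl
  rw [← ENNReal.ofReal_tsum_of_nonneg (fun n => by positivity) h1]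
  exact ENNReal.ofReal_lt_top

lemma nu2_univ (s : ℝ) : nu2 N s univ ≤ M2 s := by
  have := lint_nu2 (N := N) s (fun _ => 1)
  rw [lintegral_one] at this
  rw [this, M2]
  simp only [mul_one]
  rw [Fin.sum_univ_eq_sum_range (fun n => ENNReal.ofReal ((Real.pi * ((n:ℝ) + 1)) ^ (2 * s - 2))) N]
  exact ENNReal.sum_le_tsum _

lemma lf_be2 (u : XN N) (n : Fin N) : lf (be2 n) u = Real.pi * ((n:ℕ) + 1) * ‖cf u n‖ := by
  unfold lf be2
  simp only [ite_mul, zero_mul, Finset.sum_ite_eq', Finset.mem_univ, if_true]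
  rw [norm_mul, Complex.norm_real, Real.norm_of_nonneg (by positivity)]

lemma coefFin_lt (u : XN N) (n : Fin N) : coefFin u n = cf u n := by
  simp [coefFin, cf]

lemma coefFin_ge (u : XN N) (n : ℕ) (hn : N ≤ n) : coefFin u n = 0 := by
  simp [coefFin, hn]

lemma tsum_fin {M : Type*} [AddCommMonoid M] [TopologicalSpace M] [T2Space M] (f : ℕ → M)
    (hf : ∀ n, N ≤ n → f n = 0) : ∑' n, f n = ∑ n : Fin N, f n := by
  rw [tsum_eq_sum (s := Finset.range N), Fin.sum_univ_eq_sum_range f N]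
  intro b hb
  exact hf b (by simpa using hb)

lemma h_bound {s : ℝ} (hs : s < 1/2) (u0 u1 : XN N) (D : Fin N → ℂ) (r t : ℝ)
    (hu : ∀ n, cf u1 n = Ee n r * cf u0 n + Ee n t * D n) :
    HNorm s (coefFin u1) ≤ (ENNReal.ofReal 2 * ∫⁻ n, ENNReal.ofReal (lf (be2 n) u0 ^ (2:ℝ)) ∂(nu2 N s)
      + ENNReal.ofReal (2 * ∑ n : Fin N, (Real.pi * ((n:ℕ) + 1)) ^ 2 * ‖D n‖ ^ 2)) ^ (1/2 : ℝ) := by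
  unfold HNorm
  gcongr
  rw [tsum_fin (N := N)]
  swap
  · intro n hn; rw [coefFin_ge u1 n hn]; simp
  rw [lint_nu2, Finset.mul_sum, Finset.mul_sum, ENNReal.ofReal_sum_of_nonneg (fun _ _ => by positivity), ← Finset.sum_add_distrib]
  refine Finset.sum_le_sum fun n _ => ?_
  have hω : 1 ≤ Real.pi * ((n:ℕ) + 1 : ℝ) := by
    have := Real.pi_gt_three
    have : (0:ℝ) ≤ (n:ℕ) := by positivity
    nlinarith
  set ω := Real.pi * ((n:ℕ) + 1 : ℝ) with hωd
  have hω0 : 0 < ω := by linarith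
  rw [coefFin_lt, lf_be2, ← ENNReal.ofReal_mul (by positivity), ← ENNReal.ofReal_mul (by positivity),
    ← ENNReal.ofReal_add (by positivity) (by positivity)]
  have e : ((‖cf u1 n‖₊ : ℝ≥0∞)) ^ 2 = ENNReal.ofReal (‖cf u1 n‖ ^ 2) := by
    rw [ENNReal.ofReal_pow (norm_nonneg _)]
    congr 1
    exact (ofReal_norm _).symm
  rw [e, ← ENNReal.ofReal_mul (by positivity)]
  apply ENNReal.ofReal_le_ofReal
  rw [← hωd]
  have h1 : ‖cf u1 n‖ ≤ ‖cf u0 n‖ + ‖D n‖ := by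
    rw [hu]
    refine (norm_add_le _ _).trans ?_
    rw [norm_mul, norm_mul, norm_Ee, norm_Ee, one_mul, one_mul]
  have h2 : ‖cf u1 n‖ ^ 2 ≤ 2 * ‖cf u0 n‖ ^ 2 + 2 * ‖D n‖ ^ 2 := by
    have := norm_nonneg (cf u1 n)
    nlinarith [sq_nonneg (‖cf u0 n‖ - ‖D n‖)]
  have h3 : ω ^ (2 * s) ≤ ω ^ 2 := by
    rw [← Real.rpow_two]
    exact Real.rpow_le_rpow_of_exponent_le hω (by linarith)
  have h4 : ω ^ (2 * s - 2) * (ω * ‖cf u0 n‖) ^ (2:ℝ) = ω ^ (2 * s) * ‖cf u0 n‖ ^ 2 := by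
    rw [Real.rpow_two, mul_pow, ← mul_assoc, ← Real.rpow_two, ← Real.rpow_add hω0]
    ring_nf
  rw [h4]
  calc _ ≤ ω ^ (2 * s) * (2 * ‖cf u0 n‖ ^ 2 + 2 * ‖D n‖ ^ 2) := by gcongr
    _ = 2 * (ω ^ (2 * s) * ‖cf u0 n‖ ^ 2) + 2 * (ω ^ (2 * s) * ‖D n‖ ^ 2) := by ring
    _ ≤ _ := by gcongr

/-- space-time measure -/
def nu1 (p : ℝ) : Measure (ℝ × E3) := (volume.restrict (Ioo (0:ℝ) 3)).prod (wt (p/2))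

instance (p : ℝ) : SFinite (nu1 p) := by unfold nu1; infer_instance

lemma nu1_univ {p : ℝ} (hp : p < 6) : nu1 p univ < ⊤ := by
  rw [nu1, ← univ_prod_univ, Measure.prod_prod]
  refine ENNReal.mul_lt_top (by simp) (wt_univ (by linarith))

lemma vFun_Sc (u : XN N) (τ : ℝ) (y : E3) :
    vFun (Sc τ (coefFin u)) y = ∑ n : Fin N, Ee n (-τ) * cf u n * (eFun ((n:ℕ) + 1) y : ℂ) := by
  unfold vFun
  rw [tsum_fin (N := N)]
  · refine Finset.sum_congr rfl fun n _ => ?_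
    rw [Sc, coefFin_lt, Ee]
    push_cast
    congr 4
    ring
  · intro n hn
    simp [Sc, coefFin_ge u n hn]

lemma Ee_add (n : ℕ) (s t : ℝ) : Ee n (s + t) = Ee n s * Ee n t := by
  unfold Ee
  rw [← Complex.exp_add]
  push_cast
  ring_nf

lemma lint_shift (g : ℝ → ℝ≥0∞) (r : ℝ) (h0 : 0 ≤ r) (h1 : r ≤ 1) :
    ∫⁻ τ in Ioo (0:ℝ) 2, g (τ + r) ≤ ∫⁻ τ in Ioo (0:ℝ) 3, g τ := by
  rw [← lintegral_indicator measurableSet_Ioo, ← lintegral_indicator measurableSet_Ioo,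
    ← lintegral_add_right_eq_self (fun τ => (Ioo (0:ℝ) 3).indicator g τ) r]
  refine lintegral_mono fun τ => ?_
  by_cases h : τ ∈ Ioo (0:ℝ) 2
  · rw [indicator_of_mem h, indicator_of_mem]
    exact ⟨by linarith [h.1], by linarith [h.2]⟩
  · rw [indicator_of_notMem h]; exact bot_le

set_option maxHeartbeats 1000000 in
lemma st_bound {p : ℝ} (hp : 0 < p) (u0 u1 : XN N) (D : Fin N → ℂ) (r t : ℝ) (h0 : 0 ≤ r) (h1 : r ≤ 1)
    (hu : ∀ n, cf u1 n = Ee n (-r) * cf u0 n + Ee n (-t) * D n) :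
    stLp (ENNReal.ofReal p) (Set.Ioo 0 2) (fun τ y => vFun (Sc τ (coefFin u1)) y) ≤
      (ENNReal.ofReal (2 ^ p) * (∫⁻ z, ENNReal.ofReal (lf (be1 z) u0 ^ p) ∂(nu1 p) +
        ENNReal.ofReal 2 * (wt (p/2) univ * ENNReal.ofReal ((∑ n : Fin N, (Real.pi * ((n:ℕ) + 1)) ^ 2 * ‖D n‖ ^ 2) ^ (p/2))))) ^ (1/p) := by
  set S := ∑ n : Fin N, (Real.pi * ((n:ℕ) + 1)) ^ 2 * ‖D n‖ ^ 2 with hS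
  have hS0 : 0 ≤ S := Finset.sum_nonneg fun _ _ => by positivity
  unfold stLp
  rw [eLpNorm_eq_lintegral_rpow_enorm_toReal (by simpa using hp) (by simp), ENNReal.toReal_ofReal hp.le]
  gcongr
  have hlm : Measurable (fun z : ℝ × E3 => lf (be1 z) u0) :=
    measurable_lf' meas_be1 u0
  have hlm' : Measurable (fun z : ℝ × E3 => lf (be1 (z.1 + r, z.2)) u0) :=
    measurable_lf' (β := fun z : ℝ × E3 => be1 (z.1 + r, z.2)) (meas_be1.comp (by fun_prop : Measurable (fun z : ℝ × E3 => (z.1 + r, z.2)))) u0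
  -- pointwise bound
  have pw : ∀ τ y, y ≠ 0 → ‖y‖ ≤ 1 → ‖vFun (Sc τ (coefFin u1)) y‖ₑ ^ p ≤ ENNReal.ofReal (2 ^ p) *
      (ENNReal.ofReal (‖y‖ ^ (-(p/2))) * ENNReal.ofReal (lf (be1 (τ + r, y)) u0 ^ p) +
        ENNReal.ofReal (‖y‖ ^ (-(p/2))) * ENNReal.ofReal (S ^ (p/2))) := by
    intro τ y hy hy1
    have hy' : 0 < ‖y‖ := norm_pos_iff.2 hy
    rw [← ENNReal.ofReal_mul (by positivity), ← ENNReal.ofReal_mul (by positivity), ← ENNReal.ofReal_add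
      (mul_nonneg (by positivity) (Real.rpow_nonneg (lf_nonneg _ _) _)) (by positivity), ← ENNReal.ofReal_mul (by positivity), ← ofReal_norm,
      ENNReal.ofReal_rpow_of_nonneg (norm_nonneg _) hp.le]
    apply ENNReal.ofReal_le_ofReal
    set ρ := ‖y‖ ^ (1/2 : ℝ) with hρ
    have hρ0 : 0 < ρ := by positivity
    have hA : ‖∑ n : Fin N, Ee n (-(τ + r)) * cf u0 n * (eFun ((n:ℕ) + 1) y : ℂ)‖ = ρ⁻¹ * lf (be1 (τ + r, y)) u0 := by
      have : lf (be1 (τ + r, y)) u0 = ρ * ‖∑ n : Fin N, Ee n (-(τ + r)) * cf u0 n * (eFun ((n:ℕ) + 1) y : ℂ)‖ := by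
        unfold lf
        rw [← Real.norm_of_nonneg hρ0.le, ← Complex.norm_real, ← norm_mul, Finset.mul_sum]
        congr 1
        refine Finset.sum_congr rfl fun n _ => ?_
        unfold be1
        push_cast
        ring
      rw [this]; field_simp
    have hB : ‖∑ n : Fin N, Ee n (-(τ + t)) * D n * (eFun ((n:ℕ) + 1) y : ℂ)‖ ≤ ρ⁻¹ * Real.sqrt S := by
      have h1 : ‖∑ n : Fin N, Ee n (-(τ + t)) * D n * (eFun ((n:ℕ) + 1) y : ℂ)‖ ≤
          ∑ n : Fin N, ((Real.pi * ((n:ℕ) + 1)) * ‖D n‖) * (|eFun ((n:ℕ) + 1) y| / (Real.pi * ((n:ℕ) + 1))) := by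
        refine (norm_sum_le _ _).trans (Finset.sum_le_sum fun n _ => ?_)
        rw [norm_mul, norm_mul, norm_Ee, one_mul, Complex.norm_real, Real.norm_eq_abs]
        apply le_of_eq
        have : Real.pi * ((n:ℕ) + 1 : ℝ) ≠ 0 := by positivity
        field_simp
      refine h1.trans ((Real.sum_mul_le_sqrt_mul_sqrt _ _ _).trans ?_)
      rw [mul_comm]
      have e1 : ∑ n : Fin N, ((Real.pi * ((n:ℕ) + 1)) * ‖D n‖) ^ 2 = S := by
        rw [hS]; exact Finset.sum_congr rfl fun n _ => by rw [mul_pow (_ * _)]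
      have e2 : ∑ n : Fin N, (|eFun ((n:ℕ) + 1) y| / (Real.pi * ((n:ℕ) + 1))) ^ 2 ≤ ‖y‖⁻¹ := by
        have h := eFun_sq_sum N y hy1
        rw [← le_div_iff₀' hy', one_div] at h
        refine le_trans (le_of_eq (Finset.sum_congr rfl fun n _ => ?_)) h
        rw [div_pow, sq_abs]
      rw [e1]
      gcongr
      calc _ ≤ Real.sqrt (‖y‖⁻¹) := Real.sqrt_le_sqrt e2
        _ = ρ⁻¹ := by rw [hρ, Real.sqrt_inv, Real.sqrt_eq_rpow]
    have hsum : vFun (Sc τ (coefFin u1)) y = ∑ n : Fin N, Ee n (-(τ + r)) * cf u0 n * (eFun ((n:ℕ) + 1) y : ℂ)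
        + ∑ n : Fin N, Ee n (-(τ + t)) * D n * (eFun ((n:ℕ) + 1) y : ℂ) := by
      rw [vFun_Sc, ← Finset.sum_add_distrib]
      refine Finset.sum_congr rfl fun n _ => ?_
      rw [hu, neg_add, neg_add, Ee_add, Ee_add]
      ring
    have hl := lf_nonneg (be1 (τ + r, y)) u0
    set L := lf (be1 (τ + r, y)) u0
    have hn : ‖vFun (Sc τ (coefFin u1)) y‖ ≤ ρ⁻¹ * (L + Real.sqrt S) := by
      rw [hsum]
      refine (norm_add_le _ _).trans ?_
      rw [hA, mul_add]
      gcongr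
    have hmax : L + Real.sqrt S ≤ 2 * max L (Real.sqrt S) := by
      linarith [le_max_left L (Real.sqrt S), le_max_right L (Real.sqrt S)]
    have hρp : (ρ⁻¹) ^ p = ‖y‖ ^ (-(p/2)) := by
      rw [hρ, ← Real.rpow_neg hy'.le, ← Real.rpow_mul hy'.le]; ring_nf
    have hSp : (Real.sqrt S) ^ p = S ^ (p/2) := by
      rw [Real.sqrt_eq_rpow, ← Real.rpow_mul hS0]; ring_nf
    calc ‖vFun (Sc τ (coefFin u1)) y‖ ^ p ≤ (ρ⁻¹ * (2 * max L (Real.sqrt S))) ^ p := by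
          apply Real.rpow_le_rpow (norm_nonneg _) _ hp.le
          exact hn.trans (by gcongr)
      _ = ‖y‖ ^ (-(p/2)) * (2 ^ p * (max L (Real.sqrt S)) ^ p) := by
          rw [Real.mul_rpow (by positivity) (by positivity), Real.mul_rpow (by positivity) (by positivity), hρp]
      _ ≤ ‖y‖ ^ (-(p/2)) * (2 ^ p * (L ^ p + S ^ (p/2))) := by
          gcongr
          rw [← hSp]
          rcases max_choice L (Real.sqrt S) with h | h <;> rw [h]
          · have : 0 ≤ (Real.sqrt S) ^ p := by positivity
            linarith
          · have : 0 ≤ L ^ p := by positivity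
            linarith
      _ = _ := by ring
  have hae : ∀ᵐ z ∂((volume.restrict (Ioo (0:ℝ) 2)).prod μΘ), z.2 ≠ 0 ∧ ‖z.2‖ ≤ 1 :=
    Measure.quasiMeasurePreserving_snd.ae (ae_ne_zero.and ae_μΘ)
  have m1 : Measurable (fun z : ℝ × E3 => ENNReal.ofReal (‖z.2‖ ^ (-(p/2))) * ENNReal.ofReal (lf (be1 (z.1 + r, z.2)) u0 ^ p)) := by
    fun_prop
  have m2 : Measurable (fun z : ℝ × E3 => ENNReal.ofReal (‖z.2‖ ^ (-(p/2))) * ENNReal.ofReal (S ^ (p/2))) := by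
    fun_prop
  have m3 : Measurable (fun z : ℝ × E3 => ENNReal.ofReal (lf (be1 z) u0 ^ p)) := by fun_prop
  calc _ ≤ ∫⁻ z, ENNReal.ofReal (2 ^ p) * (ENNReal.ofReal (‖z.2‖ ^ (-(p/2))) * ENNReal.ofReal (lf (be1 (z.1 + r, z.2)) u0 ^ p) +
        ENNReal.ofReal (‖z.2‖ ^ (-(p/2))) * ENNReal.ofReal (S ^ (p/2))) ∂((volume.restrict (Ioo (0:ℝ) 2)).prod μΘ) := by
        refine lintegral_mono_ae ?_
        filter_upwards [hae] with z hz
        exact pw z.1 z.2 hz.1 hz.2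
    _ = ENNReal.ofReal (2 ^ p) * (∫⁻ z, ENNReal.ofReal (‖z.2‖ ^ (-(p/2))) * ENNReal.ofReal (lf (be1 (z.1 + r, z.2)) u0 ^ p) ∂((volume.restrict (Ioo (0:ℝ) 2)).prod μΘ)
        + ∫⁻ z, ENNReal.ofReal (‖z.2‖ ^ (-(p/2))) * ENNReal.ofReal (S ^ (p/2)) ∂((volume.restrict (Ioo (0:ℝ) 2)).prod μΘ)) := by
        rw [lintegral_const_mul' _ _ ENNReal.ofReal_ne_top, lintegral_add_left m1]
    _ ≤ _ := by
        refine mul_le_mul_right (add_le_add ?_ (le_of_eq ?_)) _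
        · rw [lintegral_prod _ m1.aemeasurable, nu1, lintegral_prod _ m3.aemeasurable]
          have hin : ∀ τ, ∫⁻ y, ENNReal.ofReal (lf (be1 (τ, y)) u0 ^ p) ∂(wt (p/2)) =
              ∫⁻ y, ENNReal.ofReal (‖y‖ ^ (-(p/2))) * ENNReal.ofReal (lf (be1 (τ, y)) u0 ^ p) ∂μΘ :=
            fun τ => lint_wt _ (m3.comp measurable_prodMk_left)
          simp_rw [hin]
          exact lint_shift (fun τ => ∫⁻ y, ENNReal.ofReal (‖y‖ ^ (-(p/2))) * ENNReal.ofReal (lf (be1 (τ, y)) u0 ^ p) ∂μΘ) r h0 h1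
        · rw [lintegral_prod _ m2.aemeasurable]
          have : ∀ τ : ℝ, ∫⁻ y, ENNReal.ofReal (‖((τ, y) : ℝ × E3).2‖ ^ (-(p/2))) * ENNReal.ofReal (S ^ (p/2)) ∂μΘ
              = wt (p/2) univ * ENNReal.ofReal (S ^ (p/2)) := by
            intro τ
            rw [lintegral_mul_const' _ _ ENNReal.ofReal_ne_top, wt, withDensity_apply _ MeasurableSet.univ, Measure.restrict_univ]
          refine (lintegral_congr this).trans ?_
          rw [lintegral_const, Measure.restrict_apply MeasurableSet.univ, univ_inter, Real.volume_Ioo, mul_comm]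
          simp
end
end

section

/-- total exponential functional -/
def VV {N : ℕ} (c p s : ℝ) (χ : ℝ → ℝ) (α : ℝ) (x : XN N) : ℝ≥0∞ :=
  Vf c (nu1 p) be1 x + Vf c (nu2 N s) be2 x + Vf c (wt ((α + 3)/2)) (be3 χ) x

lemma measurable_VV {N : ℕ} (c p s : ℝ) (χ : ℝ → ℝ) (α : ℝ) : Measurable (VV (N := N) c p s χ α) :=
  ((measurable_Vf c _ meas_be1).add (measurable_Vf c _ (measurable_of_finite _))).add
    (measurable_Vf c _ (meas_be3 χ))

set_option maxHeartbeats 1000000 in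
lemma core {α p s c X C1 : ℝ} {χ : ℝ → ℝ} (hα : 0 < α) (hα3 : α < 3) (hp4 : 4 < p) (hp6 : p < 6)
    (hs : s < 1/2) (hX : ∀ z, |χ z| ≤ X) (hX1 : 1 ≤ X) (hc : 0 < c) (hc1 : c ≤ 1) (hC1 : 0 < C1) :
    ∃ C : ℝ, 0 < C ∧ ∀ (N : ℕ) (φ : ℝ → XN N → XN N), IsFlow χ α φ → ∀ (x : XN N) (t L : ℝ), 1 ≤ L →
      ∫⁻ r in Ioc (t - 1) t, VV c p s χ α (φ r x) ≤ ENNReal.ofReal (2 * C1 * Real.exp (2 * L)) →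
      stLp (ENNReal.ofReal p) (Set.Ioo 0 2) (fun τ y => vFun (Sc τ (coefFin (φ t x))) y)
            + HNorm s (coefFin (φ t x)) ≤ ENNReal.ofReal (C * Real.sqrt L) := by
  obtain ⟨Ka, hKa, hE⟩ := pow_le_exp (2 * α) (c/4) (by linarith) (by linarith)
  obtain ⟨Cp, hCp, hsp⟩ := pow_le_split p c (by linarith) hc
  obtain ⟨C2, hC2, hs2⟩ := pow_le_split 2 c (by norm_num) hc
  obtain ⟨C3, hC3, hs3⟩ := pow_le_split (2 * (α + 1)) c (by linarith) hc
  obtain ⟨K, hK, hD⟩ := duhamel hα hα3 hX hX1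
  have f1 : nu1 p univ ≠ ⊤ := (nu1_univ hp6).ne
  have f2 : M2 s ≠ ⊤ := (M2_lt_top hs).ne
  have f3 : wt ((α + 3)/2) univ ≠ ⊤ := (wt_univ (by linarith)).ne
  have f4 : wt (p/2) univ ≠ ⊤ := (wt_univ (by linarith)).ne
  set m1 : ℝ := (nu1 p univ).toReal with hm1
  set m2 : ℝ := (M2 s).toReal with hm2
  set m3 : ℝ := (wt ((α + 3)/2) univ).toReal with hm3
  set m4 : ℝ := (wt (p/2) univ).toReal with hm4
  have n1 : 0 ≤ m1 := ENNReal.toReal_nonneg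
  have n2 : 0 ≤ m2 := ENNReal.toReal_nonneg
  have n3 : 0 ≤ m3 := ENNReal.toReal_nonneg
  have n4 : 0 ≤ m4 := ENNReal.toReal_nonneg
  set K1 : ℝ := m1 + Cp * (2 * C1 * Ka) with hK1
  set K2 : ℝ := m2 + C2 * (2 * C1 * Ka) with hK2
  set K3 : ℝ := m3 + C3 * (2 * C1) with hK3
  have p1 : 0 < K1 := by positivity
  have p2 : 0 < K2 := by positivity
  have p3 : 0 < K3 := by positivity
  set KS : ℝ := K * K3 with hKS
  have pS : 0 < KS := by positivity
  set Cst : ℝ := (2 ^ p * (K1 + 2 * (m4 * KS ^ (p/2)))) ^ (1/p) with hCst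
  set Ch : ℝ := (2 * K2 + 2 * KS) ^ (1/2 : ℝ) with hCh
  have q1 : 0 < Cst := by positivity
  have q2 : 0 < Ch := by positivity
  refine ⟨(Cst + Ch) * Real.sqrt (12 / c), by positivity, ?_⟩
  intro N φ hφ x t L hL hB
  set l : ℝ := Real.sqrt (12 / c) * Real.sqrt L with hl
  have hl2 : l ^ 2 = 12 / c * L := by
    rw [hl, mul_pow, Real.sq_sqrt (by positivity), Real.sq_sqrt (by linarith)]
  have hcl : c * l ^ 2 = 12 * L := by rw [hl2]; field_simp
  have hl0 : 0 < l := by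
    have : 0 < Real.sqrt L := Real.sqrt_pos.2 (by linarith)
    positivity
  have hl1 : 1 ≤ l := by
    have h1 : 1 ≤ l ^ 2 := by
      rw [hl2]
      have : 1 ≤ 12 / c := by rw [le_div_iff₀ hc]; linarith
      nlinarith
    nlinarith
  set h : ℝ := (l ^ (2 * α))⁻¹ with hh
  have hh0 : 0 < h := by positivity
  have hh1 : h ≤ 1 := inv_le_one_of_one_le₀ (Real.one_le_rpow hl1 (by linarith))
  set Bd : ℝ := 2 * C1 * Real.exp (2 * L) with hBd
  have hBd0 : 0 < Bd := by positivity
  have hVm : Measurable (fun r => VV c p s χ α (φ r x)) :=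
    (measurable_VV c p s χ α).comp (flow_cont hφ x).measurable
  have hB' : ∫⁻ r in Ioc (t - h) t, VV c p s χ α (φ r x) ≤ ENNReal.ofReal Bd :=
    (lintegral_mono_set (Ioc_subset_Ioc_left (by linarith))).trans hB
  have hvol : volume (Ioc (t - h) t) = ENNReal.ofReal h := by
    rw [Real.volume_Ioc]; congr 1; ring
  obtain ⟨s0, hs0, hV0⟩ := exists_le_setLAverage (μ := volume) (s := Ioc (t - h) t)
    (f := fun r => VV c p s χ α (φ r x)) (by rw [hvol]; simpa using hh0) (by rw [hvol]; simp)
    hVm.aemeasurable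
  have hV : VV c p s χ α (φ s0 x) ≤ ENNReal.ofReal (Bd * l ^ (2 * α)) := by
    refine hV0.trans ?_
    rw [setLAverage_eq, hvol]
    calc _ ≤ ENNReal.ofReal Bd / ENNReal.ofReal h := by gcongr
      _ = ENNReal.ofReal (Bd / h) := (ENNReal.ofReal_div_of_pos hh0).symm
      _ = _ := by rw [hh, div_inv_eq_mul]
  -- absorbing exponentials
  have hexp1 : ∀ C : ℝ, 0 < C → C * Real.exp (-(c * l ^ 2 / 2)) * (Bd * l ^ (2 * α)) ≤ C * (2 * C1 * Ka) := by
    intro C hC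
    have h1 := hE l hl0.le
    calc _ ≤ C * Real.exp (-(c * l ^ 2 / 2)) * (Bd * (Ka * Real.exp (c / 4 * l ^ 2))) := by gcongr
      _ = C * (2 * C1 * Ka) * (Real.exp (-(c * l ^ 2 / 2)) * Real.exp (2 * L) * Real.exp (c / 4 * l ^ 2)) := by
        rw [hBd]; ring
      _ ≤ C * (2 * C1 * Ka) * 1 := by
        gcongr
        rw [← Real.exp_add, ← Real.exp_add, Real.exp_le_one_iff]
        linarith
      _ = _ := by ring
  have hmom : ∀ (C m q : ℝ), 0 < C → 0 ≤ m → 0 ≤ q → ENNReal.ofReal (l ^ q) * ENNReal.ofReal m +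
      ENNReal.ofReal (C * Real.exp (-(c * l ^ 2 / 2))) * VV c p s χ α (φ s0 x) ≤
      ENNReal.ofReal ((m + C * (2 * C1 * Ka)) * l ^ q) := by
    intro C m q hC hm hq
    have hlq : 1 ≤ l ^ q := Real.one_le_rpow hl1 hq
    calc _ ≤ ENNReal.ofReal (l ^ q) * ENNReal.ofReal m +
          ENNReal.ofReal (C * Real.exp (-(c * l ^ 2 / 2))) * ENNReal.ofReal (Bd * l ^ (2 * α)) := by gcongr
      _ = ENNReal.ofReal (l ^ q * m + C * Real.exp (-(c * l ^ 2 / 2)) * (Bd * l ^ (2 * α))) := by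
          rw [← ENNReal.ofReal_mul (by positivity), ← ENNReal.ofReal_mul (by positivity), ← ENNReal.ofReal_add (by positivity) (by positivity)]
      _ ≤ _ := by
          apply ENNReal.ofReal_le_ofReal
          have := hexp1 C hC
          have h2 : C * (2 * C1 * Ka) ≤ C * (2 * C1 * Ka) * l ^ q := le_mul_of_one_le_right (by positivity) hlq
          linarith
  have mom1 : ∫⁻ z, ENNReal.ofReal (lf (be1 z) (φ s0 x) ^ p) ∂(nu1 p) ≤ ENNReal.ofReal (K1 * l ^ p) := by
    refine (moment (nu1 p) p c hCp hsp be1 (φ s0 x) l hl0.le).trans (le_trans ?_ (hmom Cp m1 p hCp n1 (by linarith)))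
    rw [hm1, ENNReal.ofReal_toReal f1]
    gcongr
    exact le_add_right (le_add_right le_rfl)
  have mom2 : ∫⁻ n, ENNReal.ofReal (lf (be2 n) (φ s0 x) ^ (2:ℝ)) ∂(nu2 N s) ≤ ENNReal.ofReal (K2 * l ^ (2:ℝ)) := by
    refine (moment (nu2 N s) 2 c hC2 hs2 be2 (φ s0 x) l hl0.le).trans (le_trans ?_ (hmom C2 m2 2 hC2 n2 (by norm_num)))
    rw [hm2, ENNReal.ofReal_toReal f2]
    gcongr
    · exact nu2_univ s
    · exact le_add_right (le_add_left le_rfl)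
  -- Duhamel
  have hs0t : s0 ≤ t := hs0.2
  have hts0 : t - h < s0 := hs0.1
  have hS := hD N φ hφ x s0 t hs0t (by linarith)
  set S : ℝ := ∑ n : Fin N, (Real.pi * ((n:ℕ) + 1)) ^ 2 * ‖Dd φ x s0 t n‖ ^ 2 with hSd
  have hS0 : 0 ≤ S := Finset.sum_nonneg fun _ _ => by positivity
  have hJ : ∫⁻ r in Ioc s0 t, ∫⁻ y, ENNReal.ofReal (‖y‖ ^ ((α + 3)/2 - 2) * (|wA χ (φ r x).1 y| ^ (α + 1)) ^ 2) ∂μΘ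
      ≤ ENNReal.ofReal (K3 * l ^ 2) := by
    calc _ ≤ ∫⁻ r in Ioc (t - h) t, (ENNReal.ofReal (l ^ (2 * (α + 1))) * ENNReal.ofReal m3 +
          ENNReal.ofReal (C3 * Real.exp (-(c * l ^ 2 / 2))) * VV c p s χ α (φ r x)) := by
          refine lintegral_mono' (Measure.restrict_mono (Ioc_subset_Ioc_left hts0.le) le_rfl) fun r => ?_
          refine (lint_w_lf hα (φ r x)).trans ((moment _ _ c hC3 hs3 (be3 χ) (φ r x) l hl0.le).trans ?_)
          rw [hm3, ENNReal.ofReal_toReal f3]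
          gcongr
          exact le_add_left le_rfl
      _ = ENNReal.ofReal (l ^ (2 * (α + 1))) * ENNReal.ofReal m3 * ENNReal.ofReal h +
          ENNReal.ofReal (C3 * Real.exp (-(c * l ^ 2 / 2))) * ∫⁻ r in Ioc (t - h) t, VV c p s χ α (φ r x) := by
          rw [lintegral_add_left measurable_const, lintegral_const, lintegral_const_mul' _ _ ENNReal.ofReal_ne_top,
            Measure.restrict_apply MeasurableSet.univ, univ_inter, hvol]
      _ ≤ ENNReal.ofReal (l ^ (2 * (α + 1))) * ENNReal.ofReal m3 * ENNReal.ofReal h +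
          ENNReal.ofReal (C3 * Real.exp (-(c * l ^ 2 / 2))) * ENNReal.ofReal Bd := by gcongr
      _ = ENNReal.ofReal (l ^ (2 * (α + 1)) * m3 * h + C3 * Real.exp (-(c * l ^ 2 / 2)) * Bd) := by
          rw [← ENNReal.ofReal_mul (by positivity), ← ENNReal.ofReal_mul (by positivity), ← ENNReal.ofReal_mul (by positivity),
            ← ENNReal.ofReal_add (by positivity) (by positivity)]
      _ ≤ _ := by
          apply ENNReal.ofReal_le_ofReal
          have e1 : l ^ (2 * (α + 1)) * m3 * h = m3 * l ^ 2 := by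
            rw [hh, show 2 * (α + 1) = 2 * α + 2 by ring, Real.rpow_add hl0, Real.rpow_two]
            have : l ^ (2 * α) ≠ 0 := by positivity
            field_simp
          have e2 : C3 * Real.exp (-(c * l ^ 2 / 2)) * Bd ≤ C3 * (2 * C1) := by
            calc _ = C3 * (2 * C1) * (Real.exp (-(c * l ^ 2 / 2)) * Real.exp (2 * L)) := by rw [hBd]; ring
              _ ≤ C3 * (2 * C1) * 1 := by
                gcongr
                rw [← Real.exp_add, Real.exp_le_one_iff]
                linarith
              _ = _ := by ring
          have e3 : C3 * (2 * C1) ≤ C3 * (2 * C1) * l ^ 2 := le_mul_of_one_le_right (by positivity) (by nlinarith)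
          rw [e1, hK3]
          linarith
  have hSle : S ≤ KS * l ^ 2 := by
    have := hS.trans (mul_le_mul_right hJ _)
    rw [← ENNReal.ofReal_mul hK.le, ENNReal.ofReal_le_ofReal_iff (by positivity)] at this
    rw [hKS]; linarith
  -- decomposition
  have hu : ∀ n : Fin N, cf (φ t x) n = Ee n (-(t - s0)) * cf (φ s0 x) n + Ee n (-t) * Dd φ x s0 t n := by
    intro n
    unfold Dd
    have h1 : Ee n (-t) * Ee n t = 1 := by
      rw [← Ee_add]; simp [Ee]
    have h2 : Ee n (-(t - s0)) = Ee n (-t) * Ee n s0 := by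
      rw [← Ee_add]; ring_nf
    rw [h2]
    linear_combination (-cf (φ t x) n) * h1
  have hst := st_bound (p := p) (by linarith) (φ s0 x) (φ t x) (Dd φ x s0 t) (t - s0) t (by linarith) (by linarith) hu
  have hhn := h_bound hs (φ s0 x) (φ t x) (Dd φ x s0 t) (-(t - s0)) (-t) hu
  rw [← hSd] at hst hhn
  have r1 : stLp (ENNReal.ofReal p) (Set.Ioo 0 2) (fun τ y => vFun (Sc τ (coefFin (φ t x))) y) ≤ ENNReal.ofReal (Cst * l) := by
    refine hst.trans ?_
    have hSp : S ^ (p/2) ≤ KS ^ (p/2) * l ^ p := by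
      calc S ^ (p/2) ≤ (KS * l ^ 2) ^ (p/2) := Real.rpow_le_rpow hS0 hSle (by linarith)
        _ = _ := by
          rw [Real.mul_rpow pS.le (by positivity), ← Real.rpow_natCast l 2, ← Real.rpow_mul hl0.le]
          congr 2; push_cast; ring
    calc _ ≤ (ENNReal.ofReal (2 ^ p) * (ENNReal.ofReal (K1 * l ^ p) + ENNReal.ofReal 2 * (ENNReal.ofReal m4 * ENNReal.ofReal (KS ^ (p/2) * l ^ p)))) ^ (1/p) := by
          rw [hm4, ENNReal.ofReal_toReal f4]
          gcongr
      _ = ENNReal.ofReal ((2 ^ p * (K1 + 2 * (m4 * KS ^ (p/2))) * l ^ p) ^ (1/p)) := by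
          rw [← ENNReal.ofReal_mul n4, ← ENNReal.ofReal_mul (by norm_num), ← ENNReal.ofReal_add (by positivity) (by positivity),
            ← ENNReal.ofReal_mul (by positivity), ENNReal.ofReal_rpow_of_nonneg (by positivity) (by positivity)]
          congr 2
          ring
      _ = _ := by
          congr 1
          rw [Real.mul_rpow (by positivity) (by positivity), ← Real.rpow_mul hl0.le, mul_one_div_cancel (by linarith), Real.rpow_one]
  have r2 : HNorm s (coefFin (φ t x)) ≤ ENNReal.ofReal (Ch * l) := by
    refine hhn.trans ?_
    calc _ ≤ (ENNReal.ofReal 2 * ENNReal.ofReal (K2 * l ^ (2:ℝ)) + ENNReal.ofReal (2 * (KS * l ^ 2))) ^ (1/2 : ℝ) := by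
          gcongr
      _ = ENNReal.ofReal (((2 * K2 + 2 * KS) * l ^ (2:ℝ)) ^ (1/2 : ℝ)) := by
          rw [← ENNReal.ofReal_mul (by norm_num), ← ENNReal.ofReal_add (by positivity) (by positivity),
            ENNReal.ofReal_rpow_of_nonneg (by positivity) (by positivity), Real.rpow_two]
          congr 2
          ring
      _ = _ := by
          congr 1
          rw [Real.mul_rpow (by positivity) (by positivity), ← Real.rpow_mul hl0.le,
            show (2:ℝ) * (1/2) = 1 by norm_num, Real.rpow_one]
  calc _ ≤ ENNReal.ofReal (Cst * l) + ENNReal.ofReal (Ch * l) := add_le_add r1 r2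
    _ = _ := by
      rw [← ENNReal.ofReal_add (by positivity) (by positivity)]
      congr 1
      rw [hl]; ring

lemma time_window {f : ℝ → ℝ≥0∞} {C1 : ℝ} (hC1 : 0 < C1) (i : ℕ) (t : ℝ)
    (hf : ∫⁻ r : ℝ, ENNReal.ofReal ((1 + r ^ 2)⁻¹) * f r ≤ ENNReal.ofReal (C1 * 2 ^ i)) :
    ∫⁻ r in Ioc (t - 1) t, f r ≤ ENNReal.ofReal (2 * C1 * Real.exp (2 * (i + Real.log (1 + |t|)))) := by
  have h1 : ∀ r ∈ Ioc (t - 1) t, f r ≤ ENNReal.ofReal (2 * (1 + |t|) ^ 2) * (ENNReal.ofReal ((1 + r ^ 2)⁻¹) * f r) := by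
    intro r hr
    rw [← mul_assoc, ← ENNReal.ofReal_mul (by positivity)]
    refine le_mul_of_one_le_left bot_le ?_
    rw [ENNReal.one_le_ofReal, ← div_eq_mul_inv, le_div_iff₀ (by positivity)]
    have : |r| ≤ |t| + 1 := by
      rw [abs_le]
      constructor
      · linarith [hr.1, neg_abs_le t]
      · linarith [hr.2, le_abs_self t]
    have h2 : r ^ 2 ≤ (|t| + 1) ^ 2 := by rw [← sq_abs]; gcongr
    nlinarith [abs_nonneg t]
  calc _ ≤ ∫⁻ r in Ioc (t - 1) t, ENNReal.ofReal (2 * (1 + |t|) ^ 2) * (ENNReal.ofReal ((1 + r ^ 2)⁻¹) * f r) :=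
        setLIntegral_mono' measurableSet_Ioc h1
    _ ≤ ENNReal.ofReal (2 * (1 + |t|) ^ 2) * ∫⁻ r : ℝ, (ENNReal.ofReal ((1 + r ^ 2)⁻¹) * f r) := by
        rw [lintegral_const_mul' _ _ ENNReal.ofReal_ne_top]
        gcongr
        exact Measure.restrict_le_self
    _ ≤ ENNReal.ofReal (2 * (1 + |t|) ^ 2) * ENNReal.ofReal (C1 * 2 ^ i) := by gcongr
    _ ≤ _ := by
        rw [← ENNReal.ofReal_mul (by positivity)]
        apply ENNReal.ofReal_le_ofReal
        have e1 : Real.exp (2 * (i + Real.log (1 + |t|))) = Real.exp (2 * i) * (1 + |t|) ^ 2 := by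
          rw [mul_add, Real.exp_add]
          congr 1
          rw [two_mul, Real.exp_add, Real.exp_log (by positivity)]; ring
        have e2 : (2:ℝ) ^ i ≤ Real.exp (2 * i) := by
          rw [mul_comm, Real.exp_nat_mul]
          gcongr
          have := Real.add_one_le_exp (2:ℝ)
          linarith
        rw [e1]
        calc 2 * (1 + |t|) ^ 2 * (C1 * 2 ^ i) = 2 * C1 * (2 ^ i * (1 + |t|) ^ 2) := by ring
          _ ≤ _ := by gcongr

lemma VV_avg {α p s c X : ℝ} {χ : ℝ → ℝ} (hα : 0 < α) (hX : ∀ z, |χ z| ≤ X) (hX1 : 1 ≤ X) (hc : c = 1 / (8 * X ^ 2))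
    {N : ℕ} {φ : ℝ → XN N → XN N} (hφ : IsFlow χ α φ) :
    ∫⁻ x, (∫⁻ r : ℝ, ENNReal.ofReal ((1 + r ^ 2)⁻¹) * VV c p s χ α (φ r x)) ∂(rhoN N χ α) ≤
      ENNReal.ofReal Real.pi * (2 * A0 * (nu1 p univ + M2 s + wt ((α + 3)/2) univ)) := by
  have hc0 : 0 ≤ c := by rw [hc]; positivity
  have hcX : c * X ^ 2 ≤ 1/8 := by rw [hc]; apply le_of_eq; field_simp
  have hc1 : c ≤ 1/8 := le_trans (le_mul_of_one_le_right hc0 (by nlinarith)) hcX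
  have hj := flow_joint hα hφ
  have hjs : Measurable (fun z : XN N × ℝ => φ z.2 z.1) := hj.comp measurable_swap
  have hm1 := measurable_Vf c (nu1 p) (meas_be1 (N := N))
  have hm2 := measurable_Vf c (nu2 N s) (measurable_of_finite (be2 (N := N)))
  have hm3 := measurable_Vf c (wt ((α + 3)/2)) (meas_be3 (N := N) χ)
  have aux : ∀ V : XN N → ℝ≥0∞, Measurable V → Measurable (fun z : XN N × ℝ => ENNReal.ofReal ((1 + z.2 ^ 2)⁻¹) * V (φ z.2 z.1)) := by
    intro V hV
    have := hV.comp hjs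
    exact Measurable.mul (by fun_prop) this
  have aux1 : ∀ V : XN N → ℝ≥0∞, Measurable V → Measurable (fun x : XN N => ∫⁻ r : ℝ, ENNReal.ofReal ((1 + r ^ 2)⁻¹) * V (φ r x)) :=
    fun V hV => (aux V hV).lintegral_prod_right'
  have aux2 : ∀ V : XN N → ℝ≥0∞, Measurable V → ∀ x, Measurable (fun r : ℝ => ENNReal.ofReal ((1 + r ^ 2)⁻¹) * V (φ r x)) := by
    intro V hV x
    have := hV.comp (flow_cont hφ x).measurable
    exact Measurable.mul (by fun_prop) this
  have a1 := Vf_avg hα hφ c hc0 (nu1 p) (meas_be1 (N := N)) (by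
    have h : ∀ᵐ z ∂(nu1 p), ‖z.2‖ ≤ 1 := by
      unfold nu1
      exact Measure.quasiMeasurePreserving_snd.ae (ae_wt _)
    filter_upwards [h] with z hz
    have := be1_sum (N := N) z hz
    nlinarith)
  have a2 := Vf_avg hα hφ c hc0 (nu2 N s) (measurable_of_finite (be2 (N := N))) (by
    filter_upwards with n
    have := be2_sum (N := N) n
    nlinarith)
  have a3 := Vf_avg hα hφ c hc0 (wt ((α + 3)/2)) (meas_be3 (N := N) χ) (by
    filter_upwards [ae_wt _] with y hy
    have := be3_sum (N := N) hX y hy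
    nlinarith)
  have e : ∀ x, (∫⁻ r : ℝ, ENNReal.ofReal ((1 + r ^ 2)⁻¹) * VV c p s χ α (φ r x)) =
      (∫⁻ r : ℝ, ENNReal.ofReal ((1 + r ^ 2)⁻¹) * Vf c (nu1 p) be1 (φ r x)) +
      (∫⁻ r : ℝ, ENNReal.ofReal ((1 + r ^ 2)⁻¹) * Vf c (nu2 N s) be2 (φ r x)) +
      (∫⁻ r : ℝ, ENNReal.ofReal ((1 + r ^ 2)⁻¹) * Vf c (wt ((α + 3)/2)) (be3 χ) (φ r x)) := by
    intro x
    rw [← lintegral_add_left (aux2 _ hm1 x), ← lintegral_add_right _ (aux2 _ hm3 x)]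
    refine lintegral_congr fun r => ?_
    rw [VV, mul_add, mul_add]
  rw [lintegral_congr e, lintegral_add_right _ (aux1 _ hm3), lintegral_add_left (aux1 _ hm1)]
  refine (add_le_add (add_le_add a1 a2) a3).trans ?_
  rw [← mul_add, ← mul_add, ← mul_add, ← mul_add]
  gcongr
  exact nu2_univ s

lemma chi_bdd {χ : ℝ → ℝ} (hc : Continuous χ) (hsupp : Function.support χ ⊆ Set.Ioo (-1) 1) :
    ∃ X : ℝ, 1 ≤ X ∧ ∀ z, |χ z| ≤ X := by
  obtain ⟨B, hB⟩ := (isCompact_Icc (a := (-1:ℝ)) (b := 1)).exists_bound_of_continuousOn hc.continuousOn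
  refine ⟨max 1 B, le_max_left _ _, fun z => ?_⟩
  by_cases h : z ∈ Ioo (-1:ℝ) 1
  · exact (hB z ⟨h.1.le, h.2.le⟩).trans (le_max_right _ _)
  · have : χ z = 0 := by
      by_contra h2
      exact h (hsupp h2)
    rw [this, abs_zero]
    exact zero_le_one.trans (le_max_left _ _)

end

/-- there is a constant `C` such that for all `i, N ≥ 1` one finds a set
`Σ_N^i ⊆ ℝ^{2N}` with `ρ_N((Σ_N^i)ᶜ) ≤ 2^{-i}` on which the flow `Φ_N` of the truncated
equation satisfies, for all times,
`‖S(τ)(u_{Φ_N(t,x)})‖_{L^p((0,2)×Θ)} + ‖u_{Φ_N(t,x)}‖_{H^s} ≤ C(i + log(1+|t|))^{1/2}`. -/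
theorem stmt18 (α : ℝ) (hα0 : 0 < α) (hα3 : α < 3)
    (p : ℝ) (hp : max 4 (2 * α) < p) (hp6 : p < 6)
    (s : ℝ) (hs : s < 1/2)
    (χ : ℝ → ℝ) (hχ_smooth : ContDiff ℝ (⊤ : ℕ∞) χ)
    (hχ_supp : Function.support χ ⊆ Set.Ioo (-1) 1)
    (hχ_one : Set.EqOn χ 1 (Set.Ioo (-(1/2)) (1/2)))
    (Φ : ∀ N : ℕ, ℝ → ((Fin N → ℝ) × (Fin N → ℝ)) → ((Fin N → ℝ) × (Fin N → ℝ)))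
    (hΦ0 : ∀ N x, Φ N 0 x = x)
    (hΦode : ∀ N : ℕ, ∀ x : (Fin N → ℝ) × (Fin N → ℝ), ∀ t : ℝ, ∀ n : Fin N,
      HasDerivAt (fun u => (Φ N u x).1 n) (Real.pi * ((n : ℕ) + 1) * (Φ N t x).2 n) t ∧
      HasDerivAt (fun u => (Φ N u x).2 n)
        (-(Real.pi * ((n : ℕ) + 1)) * (Φ N t x).1 n
          - (Real.pi * ((n : ℕ) + 1))⁻¹ * χ (((n : ℕ) + 1 : ℝ) ^ 2 / (N : ℝ) ^ 2) *
            ∫ y, |wA χ (Φ N t x).1 y| ^ α * wA χ (Φ N t x).1 y * eFun ((n : ℕ) + 1) y ∂μΘ) t) :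
    ∃ C : ℝ, 0 < C ∧ ∀ i : ℕ, 1 ≤ i → ∀ N : ℕ, 1 ≤ N →
      ∃ Sig : Set ((Fin N → ℝ) × (Fin N → ℝ)), MeasurableSet Sig ∧
        rhoN N χ α Sigᶜ ≤ ENNReal.ofReal ((2 : ℝ) ^ (-(i : ℝ))) ∧
        ∀ x ∈ Sig, ∀ t : ℝ,
          stLp (ENNReal.ofReal p) (Set.Ioo 0 2)
              (fun τ y => vFun (Sc τ (coefFin (Φ N t x))) y)
            + HNorm s (coefFin (Φ N t x))
          ≤ ENNReal.ofReal (C * Real.sqrt (i + Real.log (1 + |t|))) := by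
  have hp4 : 4 < p := lt_of_le_of_lt (le_max_left _ _) hp
  obtain ⟨X, hX1, hX⟩ := chi_bdd hχ_smooth.continuous hχ_supp
  obtain ⟨c, hc⟩ : ∃ c : ℝ, c = 1 / (8 * X ^ 2) := ⟨_, rfl⟩
  have hc0 : 0 < c := by rw [hc]; positivity
  have hc1 : c ≤ 1 := by
    rw [hc, div_le_one (by positivity)]
    nlinarith
  obtain ⟨T, hT⟩ : ∃ T : ℝ≥0∞, T = ENNReal.ofReal Real.pi *
    (2 * A0 * (nu1 p univ + M2 s + wt ((α + 3)/2) univ)) := ⟨_, rfl⟩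
  have hTt : T ≠ ⊤ := by
    rw [hT]
    refine ENNReal.mul_ne_top ENNReal.ofReal_ne_top (ENNReal.mul_ne_top
      (ENNReal.mul_ne_top (by norm_num) A0_lt_top.ne) ?_)
    exact ENNReal.add_ne_top.2 ⟨ENNReal.add_ne_top.2 ⟨(nu1_univ hp6).ne, (M2_lt_top hs).ne⟩,
      (wt_univ (by linarith)).ne⟩
  obtain ⟨C1, hC1⟩ : ∃ C1 : ℝ, C1 = T.toReal + 1 := ⟨_, rfl⟩
  have hC1p : 0 < C1 := by
    have : 0 ≤ T.toReal := ENNReal.toReal_nonneg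
    linarith
  have hTC : T ≤ ENNReal.ofReal C1 := by
    rw [← ENNReal.ofReal_toReal hTt]
    exact ENNReal.ofReal_le_ofReal (by linarith)
  obtain ⟨C, hC, hcore⟩ := core (C1 := C1) hα0 hα3 hp4 hp6 hs hX hX1 hc0 hc1 hC1p
  refine ⟨C, hC, fun i hi N hN => ?_⟩
  have hφ : IsFlow χ α (Φ N) := ⟨hΦ0 N, hΦode N⟩
  have hav := VV_avg (p := p) (s := s) hα0 hX hX1 hc hφ
  rw [← hT] at hav
  obtain ⟨W, hW⟩ : ∃ W : XN N → ℝ≥0∞,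
    W = fun x => ∫⁻ r : ℝ, ENNReal.ofReal ((1 + r ^ 2)⁻¹) * VV c p s χ α (Φ N r x) := ⟨_, rfl⟩
  have hWm : Measurable W := by
    have hjs : Measurable (fun z : XN N × ℝ => Φ N z.2 z.1) :=
      (flow_joint hα0 hφ).comp measurable_swap
    have h1 : Measurable (fun z : XN N × ℝ => ENNReal.ofReal ((1 + z.2 ^ 2)⁻¹) *
        VV c p s χ α (Φ N z.2 z.1)) :=
      Measurable.mul (by fun_prop) ((measurable_VV c p s χ α).comp hjs)
    rw [hW]
    exact h1.lintegral_prod_right'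
  have hav' : ∫⁻ x, W x ∂(rhoN N χ α) ≤ ENNReal.ofReal C1 := by
    rw [hW]; exact hav.trans hTC
  refine ⟨{x | W x ≤ ENNReal.ofReal (C1 * 2 ^ i)}, measurableSet_le hWm measurable_const, ?_, ?_⟩
  · have h2 : rhoN N χ α {x | ENNReal.ofReal (C1 * 2 ^ i) ≤ W x} ≤
        (∫⁻ x, W x ∂(rhoN N χ α)) / ENNReal.ofReal (C1 * 2 ^ i) :=
      meas_ge_le_lintegral_div hWm.aemeasurable
        (by rw [Ne, ENNReal.ofReal_eq_zero, not_le]; positivity) ENNReal.ofReal_ne_top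
    calc _ ≤ rhoN N χ α {x | ENNReal.ofReal (C1 * 2 ^ i) ≤ W x} := by
          apply measure_mono
          intro x hx
          have hx2 : ¬ (W x ≤ ENNReal.ofReal (C1 * 2 ^ i)) := hx
          exact (not_le.1 hx2).le
      _ ≤ _ := h2
      _ ≤ ENNReal.ofReal C1 / ENNReal.ofReal (C1 * 2 ^ i) := by gcongr
      _ = _ := by
          rw [← ENNReal.ofReal_div_of_pos (by positivity)]
          congr 1
          rw [Real.rpow_neg (by norm_num), Real.rpow_natCast]
          field_simp
  · intro x hx t
    have hlog : 0 ≤ Real.log (1 + |t|) := Real.log_nonneg (by linarith [abs_nonneg t])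
    have hi' : (1:ℝ) ≤ i := by exact_mod_cast hi
    refine hcore N (Φ N) hφ x t _ (by linarith) (time_window hC1p i t ?_)
    have hx' : W x ≤ ENNReal.ofReal (C1 * 2 ^ i) := hx
    rw [hW] at hx'
    exact hx'

end
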